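/- arXiv:1711.07590 — 2 statements merged into one kernel-verified Lean document; each statement's English description precedes it below -/
import Mathlib

section
/- Let ω be a nonnegative σ-finite measure on ℂ satisfying ∫_ℂ (1+|u|)^{−1} dω(u) < ∞. Then for Lebesgue-almost every r > 0 one has 4π²·A_r(ω) = Σ_{n=0}^∞ r^{−2n−2}·|m_{r,n}(ω)|² + Σ_{k=1}^∞ r^{2k−2}·|M_{r,k}(ω)|². -/
open MeasureTheory Metric Real Filter
open scoped ENNReal NNReal Topology

/-- Biot-Savart velocity field of a vorticity measure `ω` on `ℂ = ℝ²`: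
`v(z) = (2π)⁻¹ ∫ i (z - u) / |z - u|² dω(u)`. -/
noncomputable def biotSavart (ω : Measure ℂ) (z : ℂ) : ℂ :=
  (2 * π)⁻¹ • ∫ u, Complex.I * (z - u) / (((‖z - u‖ : ℝ) : ℂ) ^ 2) ∂ω

/-- Local kinetic energy `E_r(ω) = ∫_{B(0,r)} |v|²`. -/
noncomputable def localEnergy (ω : Measure ℂ) (r : ℝ) : ℝ≥0∞ :=
  ∫⁻ x in ball (0 : ℂ) r, (‖biotSavart ω x‖₊ : ℝ≥0∞) ^ 2

/-- Spherical average `A_r(ω) = (2π)⁻¹ ∫_0^{2π} |v(r e^{iθ})|² dθ`. -/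
noncomputable def sphAvg (ω : Measure ℂ) (r : ℝ) : ℝ≥0∞ :=
  (ENNReal.ofReal (2 * π))⁻¹ *
    ∫⁻ θ in Set.Ioo (0 : ℝ) (2 * π),
      (‖biotSavart ω ((r : ℂ) * Complex.exp ((θ : ℂ) * Complex.I))‖₊ : ℝ≥0∞) ^ 2

/-- Inner moments `m_{r,n}(ω) = ∫_{B(0,r)} uⁿ dω(u)` (for `n = 0` this is `ω(B(0,r))`). -/
noncomputable def innerMoment (ω : Measure ℂ) (r : ℝ) (n : ℕ) : ℂ :=
  ∫ u in ball (0 : ℂ) r, u ^ n ∂ω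

/-- Outer moments `M_{r,k}(ω) = ∫_{ℂ ∖ B(0,r)} u⁻ᵏ dω(u)`. -/
noncomputable def outerMoment (ω : Measure ℂ) (r : ℝ) (k : ℕ) : ℂ :=
  ∫ u in (ball (0 : ℂ) r)ᶜ, u ^ (-(k : ℤ)) ∂ω

section FourierL1

variable {T : ℝ} [hT : Fact (0 < T)]

open AddCircle

/-- An integrable function on the circle whose Fourier coefficients all vanish annihilates every
continuous function. -/
lemma integral_continuousMap_mul_eq_zero_of_fourierCoeff_eq_zero {f : AddCircle T → ℂ}
    (hf : Integrable f haarAddCircle) (h : ∀ n, fourierCoeff f n = 0) (φ : C(AddCircle T, ℂ)) :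
    ∫ t, φ t * f t ∂haarAddCircle = 0 := by
  have hint : ∀ ψ : C(AddCircle T, ℂ), Integrable (fun t => ψ t * f t) haarAddCircle := fun ψ =>
    hf.bdd_mul (c := ‖ψ‖) ψ.continuous.aestronglyMeasurable (.of_forall ψ.norm_coe_le_norm)
  let L₀ : C(AddCircle T, ℂ) →ₗ[ℂ] ℂ :=
    { toFun := fun ψ => ∫ t, ψ t * f t ∂haarAddCircle
      map_add' := fun ψ χ => by
        rw [← integral_add (hint ψ) (hint χ)]
        simp [add_mul]
      map_smul' := fun c ψ => by
        simp [mul_assoc, integral_const_mul] }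
  let L : C(AddCircle T, ℂ) →L[ℂ] ℂ := L₀.mkContinuous (∫ t, ‖f t‖ ∂haarAddCircle) fun ψ => by
    rw [mul_comm, ← integral_const_mul]
    refine norm_integral_le_of_norm_le (hf.norm.const_mul _) (.of_forall fun t => ?_)
    rw [norm_mul]
    gcongr
    exact ψ.norm_coe_le_norm t
  have hle : (Submodule.span ℂ (Set.range (@fourier T))).topologicalClosure ≤ L.ker := by
    refine Submodule.topologicalClosure_minimal _ (Submodule.span_le.2 ?_) L.isClosed_ker
    rintro _ ⟨n, rfl⟩
    change ∫ t, fourier n t * f t ∂haarAddCircle = 0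
    simpa [fourierCoeff] using h (-n)
  rw [span_fourier_closure_eq_top] at hle
  exact hle (Submodule.mem_top (x := φ))

/-- An integrable function on the circle whose Fourier coefficients all vanish is zero almost
everywhere. -/
lemma ae_eq_zero_of_fourierCoeff_eq_zero {f : AddCircle T → ℂ}
    (hf : Integrable f haarAddCircle) (h : ∀ n, fourierCoeff f n = 0) :
    f =ᵐ[haarAddCircle] 0 := by
  refine ae_eq_zero_of_forall_setIntegral_isClosed_eq_zero hf fun s hs => ?_
  rw [← integral_indicator hs.measurableSet]
  have hlim : Tendsto (fun n => ∫ t, (((hs.apprSeq n t : ℝ≥0) : ℝ) : ℂ) * f t ∂haarAddCircle) atTop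
      (𝓝 (∫ t, s.indicator f t ∂haarAddCircle)) := by
    refine tendsto_integral_of_dominated_convergence (fun t => ‖f t‖) (fun n => ?_) hf.norm
      (fun n => .of_forall fun t => ?_) (.of_forall fun t => ?_)
    · exact (by fun_prop : Continuous fun t => (((hs.apprSeq n t : ℝ≥0) : ℝ) : ℂ))
        |>.aestronglyMeasurable.mul hf.aestronglyMeasurable
    · rw [norm_mul]
      refine mul_le_of_le_one_left (norm_nonneg _) ?_
      simpa using HasOuterApproxClosed.apprSeq_apply_le_one hs n t
    · have ht := tendsto_pi_nhds.1 (HasOuterApproxClosed.tendsto_apprSeq hs) t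
      have h2 : Tendsto (fun n => (((hs.apprSeq n t : ℝ≥0) : ℝ) : ℂ)) atTop
          (𝓝 (((s.indicator (fun _ => (1 : ℝ≥0)) t : ℝ≥0) : ℝ) : ℂ)) :=
        (Complex.continuous_ofReal.comp NNReal.continuous_coe).continuousAt.tendsto.comp ht
      convert h2.mul_const (f t) using 2
      by_cases hts : t ∈ s <;> simp [hts]
  refine tendsto_nhds_unique hlim (tendsto_const_nhds.congr fun n => Eq.symm ?_)
  exact integral_continuousMap_mul_eq_zero_of_fourierCoeff_eq_zero hf h
    ⟨fun t => (((hs.apprSeq n t : ℝ≥0) : ℝ) : ℂ), by fun_prop⟩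

lemma lintegral_enorm_sq_eq_tsum_fourierCoeff_of_memLp {f : AddCircle T → ℂ}
    (hf : MemLp f 2 haarAddCircle) :
    ∫⁻ t, ‖f t‖ₑ ^ 2 ∂haarAddCircle = ∑' n : ℤ, ‖fourierCoeff f n‖ₑ ^ 2 := by
  have hs := hasSum_sq_fourierCoeff hf.toLp
  rw [fourierCoeff_congr_ae hf.coeFn_toLp] at hs
  have he : ∀ z : ℂ, ‖z‖ₑ ^ 2 = ENNReal.ofReal (‖z‖ ^ 2) := fun z => by
    rw [ENNReal.ofReal_pow (norm_nonneg _), ofReal_norm]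
  simp_rw [he]
  rw [← ENNReal.ofReal_tsum_of_nonneg (fun _ => by positivity) hs.summable, hs.tsum_eq,
    ← ofReal_integral_eq_lintegral_ofReal hf.integrable_norm_pow' (.of_forall fun _ => by positivity)]
  congr 1
  refine integral_congr_ae ?_
  filter_upwards [hf.coeFn_toLp] with t ht
  rw [ht]

/-- **Parseval's identity** for an integrable function on the circle; both sides may be infinite. -/
theorem lintegral_enorm_sq_eq_tsum_fourierCoeff {f : AddCircle T → ℂ}
    (hf : Integrable f haarAddCircle) :
    ∫⁻ t, ‖f t‖ₑ ^ 2 ∂haarAddCircle = ∑' n : ℤ, ‖fourierCoeff f n‖ₑ ^ 2 := by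
  by_cases hsum : ∑' n : ℤ, ‖fourierCoeff f n‖ₑ ^ 2 = ⊤
  · by_cases hmem : MemLp f 2 haarAddCircle
    · exact lintegral_enorm_sq_eq_tsum_fourierCoeff_of_memLp hmem
    · rw [hsum]
      by_contra hne
      refine hmem ⟨hf.aestronglyMeasurable, ?_⟩
      rw [eLpNorm_lt_top_iff_lintegral_rpow_enorm_lt_top two_ne_zero ENNReal.ofNat_ne_top]
      simpa using lt_top_iff_ne_top.2 hne
  · have hlp : Memℓp (fourierCoeff f) 2 := by
      refine memℓp_gen ?_
      have := ENNReal.summable_toReal hsum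
      simpa using this
    let h : Lp ℂ 2 (@haarAddCircle T _) := fourierBasis.repr.symm ⟨fourierCoeff f, hlp⟩
    have hc : ∀ n, fourierCoeff h n = fourierCoeff f n := fun n => by
      rw [← fourierBasis_repr]
      simp [h]
    have hh : Integrable h haarAddCircle := (Lp.memLp h).integrable one_le_two
    have hae : f - ⇑h =ᵐ[haarAddCircle] 0 := by
      refine ae_eq_zero_of_fourierCoeff_eq_zero (hf.sub hh) fun n => ?_
      have hadd := congrFun (fourierCoeff.add (hf.sub hh) hh) n
      simp only [sub_add_cancel, Pi.add_apply, hc] at hadd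
      simpa using hadd
    refine lintegral_enorm_sq_eq_tsum_fourierCoeff_of_memLp ((Lp.memLp h).ae_eq ?_)
    filter_upwards [hae] with t ht
    exact (sub_eq_zero.1 ht).symm

end FourierL1

section CauchyKernel

open AddCircle

variable {T : ℝ}

lemma norm_fourier_apply (n : ℤ) (t : AddCircle T) : ‖fourier n t‖ = 1 :=
  Circle.norm_coe _

lemma ofReal_mul_fourier_sub_ne_zero {r : ℝ} (hr : 0 < r) {u : ℂ} (hu : ‖u‖ ≠ r)
    (t : AddCircle T) : (r : ℂ) * fourier 1 t - u ≠ 0 := by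
  intro h
  apply hu
  rw [← sub_eq_zero.1 h, norm_mul, norm_fourier_apply, mul_one, Complex.norm_of_nonneg hr.le]

variable [hT : Fact (0 < T)]

lemma norm_fourierCoeff_le (f : AddCircle T → ℂ) (n : ℤ) :
    ‖fourierCoeff f n‖ ≤ ∫ t, ‖f t‖ ∂haarAddCircle := by
  refine (norm_integral_le_integral_norm _).trans_eq ?_
  simp only [norm_smul, norm_fourier_apply, one_mul]

lemma integrable_cauchyKernel {r : ℝ} (hr : 0 < r) {u : ℂ} (hu : ‖u‖ ≠ r) :
    Integrable (fun t : AddCircle T => ((r : ℂ) * fourier 1 t - u)⁻¹) haarAddCircle := by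
  have hc : Continuous (fun t : AddCircle T => ((r : ℂ) * fourier 1 t - u)⁻¹) :=
    Continuous.inv₀ (by fun_prop) (ofReal_mul_fourier_sub_ne_zero hr hu)
  exact hc.integrable_of_hasCompactSupport (HasCompactSupport.of_compactSpace _)

lemma fourierCoeff_cauchyKernel_recurrence {r : ℝ} (hr : 0 < r) {u : ℂ} (hu : ‖u‖ ≠ r) (n : ℤ) :
    r * fourierCoeff (fun t : AddCircle T => ((r : ℂ) * fourier 1 t - u)⁻¹) (n - 1) -
      u * fourierCoeff (fun t : AddCircle T => ((r : ℂ) * fourier 1 t - u)⁻¹) n =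
      if n = 0 then 1 else 0 := by
  have hK := integrable_cauchyKernel (T := T) hr hu
  have h1 : (if n = 0 then 1 else 0 : ℂ) = fourierCoeff (T := T) (fourier 0) n := by
    rw [fourierCoeff_fourier, Pi.single_apply]
  rw [h1]
  simp only [fourierCoeff]
  rw [← integral_const_mul, ← integral_const_mul,
    ← integral_sub ((hK.fourier_smul _).const_mul _) ((hK.fourier_smul _).const_mul _)]
  refine integral_congr_ae (.of_forall fun t => ?_)
  have hne := ofReal_mul_fourier_sub_ne_zero hr hu t
  have hsplit : fourier (-(n - 1)) t = fourier (-n) t * fourier 1 t := by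
    rw [← fourier_add]
    congr 2
    ring
  simp only [hsplit, smul_eq_mul, fourier_zero]
  field_simp

lemma eq_zero_of_forall_eq_pow_mul {c : ℂ} {q : ℂ} {d : ℕ → ℂ} {B : ℝ} (hq : ‖q‖ < 1)
    (hd : ∀ m, ‖d m‖ ≤ B) (h : ∀ m : ℕ, c = q ^ m * d m) : c = 0 := by
  have hlim : Tendsto (fun m : ℕ => ‖q‖ ^ m * B) atTop (𝓝 0) := by
    simpa using (tendsto_pow_atTop_nhds_zero_of_lt_one (norm_nonneg q) hq).mul_const B
  refine norm_le_zero_iff.1 (ge_of_tendsto' hlim fun m => ?_)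
  rw [h m, norm_mul, norm_pow]
  gcongr
  exact hd m

lemma fourierCoeff_cauchyKernel_of_lt_natCast {r : ℝ} (hr : 0 < r) {u : ℂ} (hu : ‖u‖ < r) (n : ℕ) :
    fourierCoeff (fun t : AddCircle T => ((r : ℂ) * fourier 1 t - u)⁻¹) n = 0 := by
  have hrC : (r : ℂ) ≠ 0 := by exact_mod_cast hr.ne'
  refine eq_zero_of_forall_eq_pow_mul (q := u / r)
    (d := fun m => fourierCoeff (fun t : AddCircle T => ((r : ℂ) * fourier 1 t - u)⁻¹) (n + m : ℕ))
    (by rwa [norm_div, Complex.norm_of_nonneg hr.le, div_lt_one hr])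
    (fun m => norm_fourierCoeff_le _ _) fun m => ?_
  induction m with
  | zero => simp
  | succ m ih =>
    have hrec := fourierCoeff_cauchyKernel_recurrence (T := T) hr hu.ne ((n + (m + 1) : ℕ) : ℤ)
    rw [if_neg (by omega), show ((n + (m + 1) : ℕ) : ℤ) - 1 = (n + m : ℕ) by push_cast; ring,
      sub_eq_zero] at hrec
    rw [ih, pow_succ, mul_assoc]
    congr 1
    rw [div_mul_eq_mul_div, ← hrec, mul_div_cancel_left₀ _ hrC]

lemma fourierCoeff_cauchyKernel_of_lt_neg {r : ℝ} (hr : 0 < r) {u : ℂ} (hu : ‖u‖ < r) (n : ℕ) :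
    fourierCoeff (fun t : AddCircle T => ((r : ℂ) * fourier 1 t - u)⁻¹) (-(n + 1)) =
      (r : ℂ)⁻¹ ^ (n + 1) * u ^ n := by
  have hrC : (r : ℂ) ≠ 0 := by exact_mod_cast hr.ne'
  induction n with
  | zero =>
    have hrec := fourierCoeff_cauchyKernel_recurrence (T := T) hr hu.ne 0
    have h0 := fourierCoeff_cauchyKernel_of_lt_natCast (T := T) hr hu 0
    rw [Nat.cast_zero] at h0
    rw [h0] at hrec
    simp only [zero_sub, mul_zero, sub_zero, if_true] at hrec
    simpa using eq_inv_of_mul_eq_one_right hrec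
  | succ n ih =>
    have hrec := fourierCoeff_cauchyKernel_recurrence (T := T) hr hu.ne (-(n + 1 : ℤ))
    rw [if_neg (by omega), ih, show -(n + 1 : ℤ) - 1 = -(((n + 1 : ℕ) : ℤ) + 1) by push_cast; ring,
      sub_eq_zero] at hrec
    refine mul_left_cancel₀ hrC (hrec.trans ?_)
    rw [pow_succ _ (n + 1), pow_succ u n]
    linear_combination (-u ^ n * u * (r : ℂ)⁻¹ ^ (n + 1)) * mul_inv_cancel₀ hrC

lemma fourierCoeff_cauchyKernel_of_gt_neg {r : ℝ} (hr : 0 < r) {u : ℂ} (hu : r < ‖u‖) (n : ℕ) :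
    fourierCoeff (fun t : AddCircle T => ((r : ℂ) * fourier 1 t - u)⁻¹) (-(n + 1)) = 0 := by
  have hu0 : u ≠ 0 := norm_pos_iff.1 (hr.trans hu)
  refine eq_zero_of_forall_eq_pow_mul (q := r / u)
    (d := fun m => fourierCoeff (fun t : AddCircle T => ((r : ℂ) * fourier 1 t - u)⁻¹)
      (-((n + m : ℕ) + 1)))
    (by rwa [norm_div, Complex.norm_of_nonneg hr.le, div_lt_one (hr.trans hu)])
    (fun m => norm_fourierCoeff_le _ _) fun m => ?_
  induction m with
  | zero => simp
  | succ m ih =>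
    have hrec := fourierCoeff_cauchyKernel_recurrence (T := T) hr hu.ne' (-((n + m : ℕ) + 1))
    rw [if_neg (by omega),
      show (-((n + m : ℕ) + 1) - 1 : ℤ) = -((n + (m + 1) : ℕ) + 1) by push_cast; ring,
      sub_eq_zero] at hrec
    rw [ih, pow_succ, mul_assoc]
    congr 1
    rw [div_mul_eq_mul_div, hrec, mul_div_cancel_left₀ _ hu0]

lemma fourierCoeff_cauchyKernel_of_gt_natCast {r : ℝ} (hr : 0 < r) {u : ℂ} (hu : r < ‖u‖) (n : ℕ) :
    fourierCoeff (fun t : AddCircle T => ((r : ℂ) * fourier 1 t - u)⁻¹) n =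
      -(r : ℂ) ^ n * u ^ (-((n + 1 : ℕ) : ℤ)) := by
  have hu0 : u ≠ 0 := norm_pos_iff.1 (hr.trans hu)
  rw [zpow_neg, zpow_natCast]
  refine mul_left_cancel₀ hu0 ?_
  induction n with
  | zero =>
    have hrec := fourierCoeff_cauchyKernel_recurrence (T := T) hr hu.ne' 0
    have h0 := fourierCoeff_cauchyKernel_of_gt_neg (T := T) hr hu 0
    rw [Nat.cast_zero, zero_add] at h0
    rw [zero_sub, h0, if_pos rfl, mul_zero, zero_sub] at hrec
    rw [Nat.cast_zero, neg_eq_iff_eq_neg.1 hrec]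
    field_simp
    simp
  | succ n ih =>
    have hrec := fourierCoeff_cauchyKernel_recurrence (T := T) hr hu.ne' ((n + 1 : ℕ) : ℤ)
    rw [if_neg (by omega), show ((n + 1 : ℕ) : ℤ) - 1 = n by push_cast; ring, sub_eq_zero] at hrec
    rw [← hrec, mul_left_cancel₀ hu0 ih]
    field_simp
    ring

end CauchyKernel

lemma lintegral_ball_enorm_inv_lt_top (R : ℝ) : ∫⁻ z in ball (0 : ℂ) R, ‖z⁻¹‖ₑ < ⊤ := by
  have h : IntegrableOn (fun z : ℂ => z⁻¹) (ball 0 R) :=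
    integrableOn_ball_of_norm_le_rpow (C := 1) (α := 1) (by simp) (by simp)
      (.of_forall fun z => by simp [Real.rpow_neg_one]) (by fun_prop)
  exact h.2

lemma lintegral_ball_enorm_inv_sub_le (R : ℝ) (u : ℂ) :
    ∫⁻ z in ball (0 : ℂ) R, ‖(z - u)⁻¹‖ₑ ≤
      (∫⁻ z in ball (0 : ℂ) 1, ‖z⁻¹‖ₑ) + volume (ball (0 : ℂ) R) := by
  calc ∫⁻ z in ball (0 : ℂ) R, ‖(z - u)⁻¹‖ₑ
      ≤ ∫⁻ z in ball (0 : ℂ) R, ((ball (0 : ℂ) 1).indicator (fun w => ‖w⁻¹‖ₑ) (z - u) + 1) := by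
        refine lintegral_mono fun z => ?_
        by_cases hz : z - u ∈ ball (0 : ℂ) 1
        · simp [hz]
        · rw [Set.indicator_of_notMem hz, zero_add]
          rw [mem_ball_zero_iff, not_lt] at hz
          rw [← ofReal_norm, norm_inv, ENNReal.ofReal_le_one]
          exact inv_le_one_of_one_le₀ hz
    _ ≤ (∫⁻ z, (ball (0 : ℂ) 1).indicator (fun w => ‖w⁻¹‖ₑ) (z - u)) + volume (ball (0 : ℂ) R) := by
        rw [lintegral_add_right _ measurable_const]
        gcongr
        · exact Measure.restrict_le_self
        · simp
    _ = _ := by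
        rw [lintegral_sub_right_eq_self (fun w => (ball (0 : ℂ) 1).indicator (fun w => ‖w⁻¹‖ₑ) w) u,
          lintegral_indicator measurableSet_ball]

lemma enorm_inv_sub_le {R : ℝ} {z : ℂ} (hz : z ∈ ball (0 : ℂ) R) (u : ℂ) :
    ‖(z - u)⁻¹‖ₑ ≤
      ENNReal.ofReal ((1 + ‖u‖)⁻¹) * (1 + ENNReal.ofReal (1 + R) * ‖(z - u)⁻¹‖ₑ) := by
  rw [mem_ball_zero_iff] at hz
  have hR : 0 < R := (norm_nonneg z).trans_lt hz
  rcases eq_or_ne z u with rfl | hne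
  · simp
  have hpos : 0 < ‖z - u‖ := norm_pos_iff.2 (sub_ne_zero.2 hne)
  have hu : ‖u‖ ≤ ‖z‖ + ‖z - u‖ := by
    simpa using norm_sub_le z (z - u)
  rw [← ofReal_norm, norm_inv, ← ENNReal.ofReal_one, ← ENNReal.ofReal_mul (by positivity),
    ← ENNReal.ofReal_add (by positivity) (by positivity), ← ENNReal.ofReal_mul (by positivity)]
  refine ENNReal.ofReal_le_ofReal ?_
  have : 0 < 1 + ‖u‖ := by positivity
  field_simp
  linarith

/-- The Cauchy potential of a measure of sublinear growth is locally integrable. -/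
lemma lintegral_ball_lintegral_enorm_inv_sub_lt_top (ω : Measure ℂ) [SigmaFinite ω]
    (hω : ∫⁻ u, ENNReal.ofReal ((1 + ‖u‖)⁻¹) ∂ω < ⊤) (R : ℝ) :
    ∫⁻ z in ball (0 : ℂ) R, ∫⁻ u, ‖(z - u)⁻¹‖ₑ ∂ω < ⊤ := by
  rw [lintegral_lintegral_swap (by fun_prop)]
  set C := (∫⁻ z in ball (0 : ℂ) 1, ‖z⁻¹‖ₑ) + volume (ball (0 : ℂ) R)
  have hCtop : C < ⊤ := ENNReal.add_lt_top.2 ⟨lintegral_ball_enorm_inv_lt_top 1, measure_ball_lt_top⟩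
  calc ∫⁻ u, (∫⁻ z in ball (0 : ℂ) R, ‖(z - u)⁻¹‖ₑ) ∂ω
      ≤ ∫⁻ u, ENNReal.ofReal ((1 + ‖u‖)⁻¹) *
          (volume (ball (0 : ℂ) R) + ENNReal.ofReal (1 + R) * C) ∂ω := by
        refine lintegral_mono fun u => ?_
        calc ∫⁻ z in ball (0 : ℂ) R, ‖(z - u)⁻¹‖ₑ
            ≤ ∫⁻ z in ball (0 : ℂ) R, ENNReal.ofReal ((1 + ‖u‖)⁻¹) *
                (1 + ENNReal.ofReal (1 + R) * ‖(z - u)⁻¹‖ₑ) :=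
              setLIntegral_mono' measurableSet_ball fun z hz => enorm_inv_sub_le hz u
          _ ≤ _ := by
              rw [lintegral_const_mul _ (by fun_prop), lintegral_add_left measurable_const,
                lintegral_const_mul _ (by fun_prop)]
              gcongr
              · simp
              · exact lintegral_ball_enorm_inv_sub_le R u
    _ < ⊤ := by
        rw [lintegral_mul_const _ (by fun_prop)]
        have := measure_ball_lt_top (μ := (volume : Measure ℂ)) (x := 0) (r := R)
        exact ENNReal.mul_lt_top hω (ENNReal.add_lt_top.2
          ⟨this, ENNReal.mul_lt_top ENNReal.ofReal_lt_top hCtop⟩)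

lemma ae_lintegral_Ioo_lt_top (ω : Measure ℂ) [SigmaFinite ω]
    (hω : ∫⁻ u, ENNReal.ofReal ((1 + ‖u‖)⁻¹) ∂ω < ⊤) :
    ∀ᵐ r : ℝ ∂(volume.restrict (Set.Ioi (0 : ℝ))),
      ∫⁻ θ in Set.Ioo (-π) π,
        ∫⁻ u, ‖((r : ℂ) * Complex.exp (θ * Complex.I) - u)⁻¹‖ₑ ∂ω < ⊤ := by
  set H : ℂ → ℝ≥0∞ := fun z => ∫⁻ u, ‖(z - u)⁻¹‖ₑ ∂ω
  have hHm : Measurable H :=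
    Measurable.lintegral_prod_right' (ν := ω) (f := fun p : ℂ × ℂ => ‖(p.1 - p.2)⁻¹‖ₑ) (by fun_prop)
  have hpolar : ∀ p : ℝ × ℝ, Complex.polarCoord.symm p = (p.1 : ℂ) * Complex.exp (p.2 * Complex.I) :=
    fun p => by rw [Complex.polarCoord_symm_apply, Complex.exp_mul_I, Complex.ofReal_cos,
      Complex.ofReal_sin]
  have hN : ∀ N : ℕ, ∀ᵐ r : ℝ ∂(volume.restrict (Set.Ioi (0 : ℝ))),
      ∫⁻ θ in Set.Ioo (-π) π, ENNReal.ofReal r *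
        (ball (0 : ℂ) N).indicator H ((r : ℂ) * Complex.exp (θ * Complex.I)) < ⊤ := by
    intro N
    have hfin := lintegral_ball_lintegral_enorm_inv_sub_lt_top ω hω N
    have hind : Measurable ((ball (0 : ℂ) N).indicator H) := hHm.indicator measurableSet_ball
    rw [← lintegral_indicator measurableSet_ball, ← Complex.lintegral_comp_polarCoord_symm,
      polarCoord_target, Measure.volume_eq_prod, ← Measure.prod_restrict] at hfin
    simp only [hpolar, smul_eq_mul] at hfin
    have hmeas : Measurable fun p : ℝ × ℝ => ENNReal.ofReal p.1 *
        (ball (0 : ℂ) N).indicator H ((p.1 : ℂ) * Complex.exp (p.2 * Complex.I)) :=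
      (by fun_prop : Measurable fun p : ℝ × ℝ => ENNReal.ofReal p.1).mul
        (hind.comp (by fun_prop))
    rw [lintegral_prod _ hmeas.aemeasurable] at hfin
    exact ae_lt_top hmeas.lintegral_prod_right' hfin.ne
  filter_upwards [ae_all_iff.2 hN, ae_restrict_mem measurableSet_Ioi] with r hr hr0
  rw [Set.mem_Ioi] at hr0
  obtain ⟨N, hN⟩ := exists_nat_gt r
  have hrN := hr N
  rw [lintegral_const_mul' _ _ ENNReal.ofReal_ne_top] at hrN
  have hmem : ∀ θ : ℝ, (r : ℂ) * Complex.exp (θ * Complex.I) ∈ ball (0 : ℂ) N := fun θ => by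
    simpa [Complex.norm_exp_ofReal_mul_I, abs_of_pos hr0] using hN
  simp only [Set.indicator_of_mem (hmem _)] at hrN
  exact ENNReal.lt_top_of_mul_ne_top_right hrN.ne (by simpa using hr0)

section Moments

open AddCircle

local instance fact_two_pi_pos : Fact (0 < 2 * π) := ⟨two_pi_pos⟩

lemma fourier_one_coe_two_pi (θ : ℝ) :
    fourier 1 (θ : AddCircle (2 * π)) = Complex.exp (θ * Complex.I) := by
  have hpi : (π : ℂ) ≠ 0 := by exact_mod_cast pi_ne_zero
  rw [fourier_coe_apply]
  congr 1
  push_cast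
  field_simp

lemma lintegral_Ioo_comp_fourier_one (a : ℝ) (f : ℂ → ℝ≥0∞) :
    ∫⁻ θ in Set.Ioo a (a + 2 * π), f (Complex.exp ((θ : ℂ) * Complex.I)) =
      ENNReal.ofReal (2 * π) *
        ∫⁻ t : AddCircle (2 * π), f (fourier 1 t) ∂haarAddCircle := by
  rw [← smul_eq_mul (ENNReal.ofReal (2 * π)), ← lintegral_smul_measure, ← volume_eq_smul_haarAddCircle,
    ← AddCircle.lintegral_preimage (2 * π) a, restrict_Ioo_eq_restrict_Ioc]
  simp only [fourier_one_coe_two_pi]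

lemma biotSavart_eq (ω : Measure ℂ) (z : ℂ) :
    biotSavart ω z =
      (2 * π)⁻¹ • (Complex.I * (starRingEnd ℂ) (∫ u, (z - u)⁻¹ ∂ω)) := by
  rw [biotSavart, ← integral_conj, ← integral_const_mul]
  congr 2
  funext u
  rw [Complex.inv_def, map_mul, Complex.conj_conj, Complex.conj_ofReal, Complex.normSq_eq_norm_sq,
    mul_div_assoc, div_eq_mul_inv]
  push_cast
  ring

lemma enorm_biotSavart (ω : Measure ℂ) (z : ℂ) :
    ‖biotSavart ω z‖ₑ = (ENNReal.ofReal (2 * π))⁻¹ * ‖∫ u, (z - u)⁻¹ ∂ω‖ₑ := by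
  rw [biotSavart_eq, enorm_smul, enorm_mul, Real.enorm_of_nonneg (by positivity),
    ENNReal.ofReal_inv_of_pos two_pi_pos, ← ofReal_norm Complex.I, Complex.norm_I,
    ENNReal.ofReal_one, one_mul, ← ofReal_norm, ← ofReal_norm, RCLike.norm_conj]

/-- The spherical average as a mean square of the Cauchy potential over the unit circle. -/
lemma four_pi_sq_mul_sphAvg (ω : Measure ℂ) (r : ℝ) :
    ENNReal.ofReal (4 * π ^ 2) * sphAvg ω r =
      ∫⁻ t : AddCircle (2 * π), ‖∫ u, ((r : ℂ) * fourier 1 t - u)⁻¹ ∂ω‖ₑ ^ 2 ∂haarAddCircle := by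
  have hI := lintegral_Ioo_comp_fourier_one 0 fun w => ‖biotSavart ω (r * w)‖ₑ ^ 2
  rw [zero_add] at hI
  change _ * (_ * ∫⁻ θ in Set.Ioo (0 : ℝ) (2 * π),
    ‖biotSavart ω ((r : ℂ) * Complex.exp ((θ : ℂ) * Complex.I))‖ₑ ^ 2) = _
  have h0 : ENNReal.ofReal (2 * π) ≠ 0 := by simpa using pi_pos
  have htop : ENNReal.ofReal (2 * π) ≠ ⊤ := ENNReal.ofReal_ne_top
  rw [hI, ← mul_assoc _ (ENNReal.ofReal (2 * π)), ENNReal.inv_mul_cancel h0 htop, one_mul]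
  simp only [enorm_biotSavart, mul_pow]
  rw [lintegral_const_mul' _ _ (ENNReal.pow_ne_top (ENNReal.inv_ne_top.2 h0)), ← mul_assoc,
    show 4 * π ^ 2 = (2 * π) ^ 2 by ring, ENNReal.ofReal_pow two_pi_pos.le, ← mul_pow,
    ENNReal.mul_inv_cancel h0 htop, one_pow, one_mul]

variable {ω : Measure ℂ} {r : ℝ}

lemma ae_norm_ne_of_null (hr : ω {u | ‖u‖ = r} = 0) : ∀ᵐ u ∂ω, ‖u‖ ≠ r := by
  rw [ae_iff]
  simpa using hr

variable [SigmaFinite ω]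

lemma measurable_cauchyKernel_uncurry (r : ℝ) :
    Measurable fun p : AddCircle (2 * π) × ℂ => ((r : ℂ) * fourier 1 p.1 - p.2)⁻¹ := by
  have h : Measurable fun t : AddCircle (2 * π) => fourier 1 t := (fourier 1).continuous.measurable
  exact ((measurable_const.mul (h.comp measurable_fst)).sub measurable_snd).inv

lemma integrable_cauchyKernel_prod
    (hfin : ∫⁻ θ in Set.Ioo (-π) π,
      ∫⁻ u, ‖((r : ℂ) * Complex.exp (θ * Complex.I) - u)⁻¹‖ₑ ∂ω < ⊤) :
    Integrable (fun p : AddCircle (2 * π) × ℂ => ((r : ℂ) * fourier 1 p.1 - p.2)⁻¹)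
      (haarAddCircle.prod ω) := by
  have hm := measurable_cauchyKernel_uncurry r
  refine ⟨hm.aestronglyMeasurable, ?_⟩
  rw [HasFiniteIntegral, lintegral_prod _ hm.enorm.aemeasurable]
  have hI := lintegral_Ioo_comp_fourier_one (-π) fun w => ∫⁻ u, ‖((r : ℂ) * w - u)⁻¹‖ₑ ∂ω
  rw [show -π + 2 * π = π by ring] at hI
  rw [hI] at hfin
  exact ENNReal.lt_top_of_mul_ne_top_right hfin.ne (by simpa using pi_pos)

lemma fourierCoeff_integral_cauchyKernel
    (hint : Integrable (fun p : AddCircle (2 * π) × ℂ => ((r : ℂ) * fourier 1 p.1 - p.2)⁻¹)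
      (haarAddCircle.prod ω)) (n : ℤ) :
    fourierCoeff (fun t : AddCircle (2 * π) => ∫ u, ((r : ℂ) * fourier 1 t - u)⁻¹ ∂ω) n =
      ∫ u, fourierCoeff (fun t : AddCircle (2 * π) => ((r : ℂ) * fourier 1 t - u)⁻¹) n ∂ω := by
  simp only [fourierCoeff, ← integral_smul]
  refine integral_integral_swap ?_
  have hc : Continuous fun p : AddCircle (2 * π) × ℂ => fourier (-n) p.1 := by fun_prop
  exact hint.bdd_smul 1 hc.aestronglyMeasurable
    (.of_forall fun p => (norm_fourier_apply (-n) p.1).le)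

lemma fourierCoeff_integral_cauchyKernel_natCast (hr0 : 0 < r) (hr : ω {u | ‖u‖ = r} = 0)
    (hint : Integrable (fun p : AddCircle (2 * π) × ℂ => ((r : ℂ) * fourier 1 p.1 - p.2)⁻¹)
      (haarAddCircle.prod ω)) (n : ℕ) :
    fourierCoeff (fun t : AddCircle (2 * π) => ∫ u, ((r : ℂ) * fourier 1 t - u)⁻¹ ∂ω) n =
      -(r : ℂ) ^ n * outerMoment ω r (n + 1) := by
  rw [fourierCoeff_integral_cauchyKernel hint, outerMoment, ← integral_const_mul,
    ← integral_indicator measurableSet_ball.compl]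
  refine integral_congr_ae ?_
  filter_upwards [ae_norm_ne_of_null hr] with u hu
  rcases lt_or_gt_of_ne hu with h | h
  · rw [fourierCoeff_cauchyKernel_of_lt_natCast hr0 h, Set.indicator_of_notMem (by simpa using h)]
  · rw [fourierCoeff_cauchyKernel_of_gt_natCast hr0 h, Set.indicator_of_mem (by simpa using h.le)]

lemma fourierCoeff_integral_cauchyKernel_neg (hr0 : 0 < r) (hr : ω {u | ‖u‖ = r} = 0)
    (hint : Integrable (fun p : AddCircle (2 * π) × ℂ => ((r : ℂ) * fourier 1 p.1 - p.2)⁻¹)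
      (haarAddCircle.prod ω)) (n : ℕ) :
    fourierCoeff (fun t : AddCircle (2 * π) => ∫ u, ((r : ℂ) * fourier 1 t - u)⁻¹ ∂ω) (-(n + 1)) =
      (r : ℂ)⁻¹ ^ (n + 1) * innerMoment ω r n := by
  rw [fourierCoeff_integral_cauchyKernel hint, innerMoment, ← integral_const_mul,
    ← integral_indicator measurableSet_ball]
  refine integral_congr_ae ?_
  filter_upwards [ae_norm_ne_of_null hr] with u hu
  rcases lt_or_gt_of_ne hu with h | h
  · rw [fourierCoeff_cauchyKernel_of_lt_neg hr0 h, Set.indicator_of_mem (by simpa using h)]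
  · rw [fourierCoeff_cauchyKernel_of_gt_neg hr0 h, Set.indicator_of_notMem (by simpa using h.le)]

lemma four_pi_sq_mul_sphAvg_eq_tsum_moments (hr0 : 0 < r) (hr : ω {u | ‖u‖ = r} = 0)
    (hfin : ∫⁻ θ in Set.Ioo (-π) π,
      ∫⁻ u, ‖((r : ℂ) * Complex.exp (θ * Complex.I) - u)⁻¹‖ₑ ∂ω < ⊤) :
    ENNReal.ofReal (4 * π ^ 2) * sphAvg ω r =
      (∑' n : ℕ, ENNReal.ofReal (r ^ (-2 * (n : ℤ) - 2) * ‖innerMoment ω r n‖ ^ 2)) +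
      ∑' k : ℕ,
        ENNReal.ofReal (r ^ (2 * ((k : ℤ) + 1) - 2) * ‖outerMoment ω r (k + 1)‖ ^ 2) := by
  have hint := integrable_cauchyKernel_prod hfin
  rw [four_pi_sq_mul_sphAvg, lintegral_enorm_sq_eq_tsum_fourierCoeff hint.integral_prod_left,
    tsum_of_nat_of_neg_add_one ENNReal.summable ENNReal.summable, add_comm]
  congr 1
  · refine tsum_congr fun n => ?_
    rw [fourierCoeff_integral_cauchyKernel_neg hr0 hr hint, ← ofReal_norm,
      ← ENNReal.ofReal_pow (norm_nonneg _), norm_mul, norm_pow, norm_inv,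
      Complex.norm_of_nonneg hr0.le, mul_pow, ← pow_mul, inv_pow, ← zpow_natCast, ← zpow_neg]
    congr 3
    push_cast
    ring
  · refine tsum_congr fun n => ?_
    rw [fourierCoeff_integral_cauchyKernel_natCast hr0 hr hint, ← ofReal_norm,
      ← ENNReal.ofReal_pow (norm_nonneg _), norm_mul, norm_neg, norm_pow,
      Complex.norm_of_nonneg hr0.le, mul_pow, ← pow_mul, ← zpow_natCast]
    congr 3
    push_cast
    ring

end Moments

/-- Theorem 1.2: moment representation of the spherical averages, for a.e. `r > 0`. -/
theorem stmt1 (ω : Measure ℂ) [SigmaFinite ω]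
    (hω : ∫⁻ u, ENNReal.ofReal ((1 + ‖u‖)⁻¹) ∂ω < ⊤) :
    ∀ᵐ r ∂(volume.restrict (Set.Ioi (0 : ℝ))),
      ENNReal.ofReal (4 * π ^ 2) * sphAvg ω r =
        (∑' n : ℕ, ENNReal.ofReal (r ^ (-2 * (n : ℤ) - 2) * ‖innerMoment ω r n‖ ^ 2)) +
        ∑' k : ℕ,
          ENNReal.ofReal (r ^ (2 * ((k : ℤ) + 1) - 2) * ‖outerMoment ω r (k + 1)‖ ^ 2) := by
  have hnull : ∀ᵐ r : ℝ ∂(volume.restrict (Set.Ioi (0 : ℝ))), ω {u | ‖u‖ = r} = 0 := by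
    refine ae_restrict_of_ae ?_
    filter_upwards [(Measure.countable_meas_level_set_pos (μ := ω)
      (measurable_norm (α := ℂ))).ae_notMem volume] with r hr
    simpa using hr
  filter_upwards [ae_restrict_mem measurableSet_Ioi, hnull, ae_lintegral_Ioo_lt_top ω hω]
    with r hr0 hr hfin
  exact four_pi_sq_mul_sphAvg_eq_tsum_moments hr0 hr hfin
end

section
/- Let ω be a nonnegative σ-finite measure on ℂ satisfying ω(B(0,r)) = c·r^α for every r > 0, with c > 0 and α ∈ (0,1). Then for every r > 0 the spherical average satisfies (c²/(4π²))·r^{2α−2} ≤ A_r(ω) ≤ (c²·α²/(4·sin²(πα)))·r^{2α−2}. -/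
open MeasureTheory Metric Real Filter
open scoped ENNReal NNReal Topology

/-- The `n`-th Fourier coefficient of `θ ↦ (r e^{iθ} - u)⁻¹`. -/
noncomputable def cauchyCoeff (r : ℝ) (n : ℤ) (u : ℂ) : ℂ :=
  fourierCoeffOn Real.two_pi_pos (fun θ => (circleMap 0 r θ - u)⁻¹) n

lemma fourierCoeffOn_two_pi (f : ℝ → ℂ) (n : ℤ) :
    fourierCoeffOn Real.two_pi_pos f n =
      (2 * π)⁻¹ • ∫ θ in (0 : ℝ)..(2 * π), Complex.exp (-(n * θ * Complex.I)) * f θ := by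
  rw [fourierCoeffOn_eq_integral]
  simp only [sub_zero, one_div, smul_eq_mul]
  congr 1
  refine intervalIntegral.integral_congr fun θ _ => ?_
  rw [fourier_coe_apply]
  congr 2
  have : (π : ℂ) ≠ 0 := by exact_mod_cast Real.pi_ne_zero
  push_cast
  field_simp
  ring

lemma circleMap_sub_ne_zero {r : ℝ} (hr : 0 < r) {u : ℂ} (hu : ‖u‖ ≠ r) (θ : ℝ) :
    circleMap 0 r θ - u ≠ 0 := by
  intro h
  apply hu
  rw [← sub_eq_zero.mp h, norm_circleMap_zero, abs_of_pos hr]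

lemma abs_sub_norm_le_norm_circleMap_sub {r : ℝ} (hr : 0 < r) (u : ℂ) (θ : ℝ) :
    |r - ‖u‖| ≤ ‖circleMap 0 r θ - u‖ := by
  have := abs_norm_sub_norm_le (circleMap 0 r θ) u
  rwa [norm_circleMap_zero, abs_of_pos hr] at this

lemma norm_exp_neg_int_mul_mul_I (n : ℤ) (θ : ℝ) :
    ‖Complex.exp (-(n * θ * Complex.I))‖ = 1 := by
  have := Complex.norm_exp_ofReal_mul_I (-(n * θ))
  simpa using this

lemma norm_cauchyCoeff_le {r : ℝ} (hr : 0 < r) (n : ℤ) {u : ℂ} (hu : ‖u‖ ≠ r) :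
    ‖cauchyCoeff r n u‖ ≤ |r - ‖u‖|⁻¹ := by
  rw [cauchyCoeff, fourierCoeffOn_two_pi, norm_smul]
  have hp : 0 < |r - ‖u‖| := abs_pos.mpr (sub_ne_zero.mpr hu.symm)
  have := intervalIntegral.norm_integral_le_of_norm_le_const (a := 0) (b := 2 * π)
    (f := fun θ : ℝ => Complex.exp (-(n * θ * Complex.I)) * (circleMap 0 r θ - u)⁻¹)
    (C := |r - ‖u‖|⁻¹) (fun θ _ => by
      rw [norm_mul, norm_exp_neg_int_mul_mul_I, one_mul, norm_inv]
      exact inv_anti₀ hp (abs_sub_norm_le_norm_circleMap_sub hr u θ))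
  have hpi := Real.two_pi_pos
  rw [sub_zero, abs_of_pos hpi] at this
  rw [norm_inv, Real.norm_of_nonneg hpi.le, inv_mul_le_iff₀ hpi]
  linarith

lemma integral_exp_neg_int_mul_mul_I (n : ℤ) :
    ∫ θ in (0 : ℝ)..(2 * π), Complex.exp (-(n * θ * Complex.I)) =
      (if n = 0 then 2 * π else 0 : ℂ) := by
  split_ifs with h
  · simp [h]
  · have hc : -(n * Complex.I) ≠ 0 := by simp [h]
    have h1 := integral_exp_mul_complex (a := 0) (b := 2 * π) hc
    have h2 : Complex.exp (-(n * Complex.I) * (2 * π : ℝ)) = 1 := by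
      rw [Complex.exp_eq_one_iff]
      exact ⟨-n, by push_cast; ring⟩
    rw [h2] at h1
    simp only [Complex.ofReal_zero, mul_zero, Complex.exp_zero, sub_self, zero_div] at h1
    rw [← h1]
    refine intervalIntegral.integral_congr fun θ _ => ?_
    congr 1
    ring

lemma continuous_inv_circleMap_sub {r : ℝ} (hr : 0 < r) {u : ℂ} (hu : ‖u‖ ≠ r) :
    Continuous fun θ => (circleMap 0 r θ - u)⁻¹ :=
  ((continuous_circleMap 0 r).sub continuous_const).inv₀ (circleMap_sub_ne_zero hr hu)

lemma cauchyCoeff_rec {r : ℝ} (hr : 0 < r) (n : ℤ) {u : ℂ} (hu : ‖u‖ ≠ r) :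
    r * cauchyCoeff r (n - 1) u = (if n = 0 then 1 else 0) + u * cauchyCoeff r n u := by
  have hcont := continuous_inv_circleMap_sub hr hu
  have hpi : (π : ℂ) ≠ 0 := by exact_mod_cast Real.pi_ne_zero
  have key : ∀ θ : ℝ, (r : ℂ) * (Complex.exp (-((n - 1 : ℤ) * θ * Complex.I)) *
      (circleMap 0 r θ - u)⁻¹) = Complex.exp (-(n * θ * Complex.I)) +
      u * (Complex.exp (-(n * θ * Complex.I)) * (circleMap 0 r θ - u)⁻¹) := by
    intro θ
    have hne := circleMap_sub_ne_zero hr hu θ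
    have : Complex.exp (-((n - 1 : ℤ) * θ * Complex.I)) =
        Complex.exp (-(n * θ * Complex.I)) * Complex.exp (θ * Complex.I) := by
      rw [← Complex.exp_add]; congr 1; push_cast; ring
    rw [this]
    rw [circleMap_zero] at hne ⊢
    field_simp
    ring
  have h1 := integral_exp_neg_int_mul_mul_I n
  have h2 : (r : ℂ) * ∫ θ in (0 : ℝ)..(2 * π), (Complex.exp (-((n - 1 : ℤ) * θ * Complex.I)) *
      (circleMap 0 r θ - u)⁻¹) = (if n = 0 then 2 * π else 0 : ℂ) +
      u * ∫ θ in (0 : ℝ)..(2 * π), (Complex.exp (-(n * θ * Complex.I)) *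
        (circleMap 0 r θ - u)⁻¹) := by
    rw [← h1, ← intervalIntegral.integral_const_mul, ← intervalIntegral.integral_const_mul,
      ← intervalIntegral.integral_add]
    · exact intervalIntegral.integral_congr fun θ _ => key θ
    · exact Continuous.intervalIntegrable (by fun_prop) _ _
    · exact Continuous.intervalIntegrable (by fun_prop) _ _
  simp only [cauchyCoeff, fourierCoeffOn_two_pi, Complex.real_smul]
  rw [mul_left_comm, h2]
  generalize ∫ θ in (0 : ℝ)..(2 * π), (Complex.exp (-(n * θ * Complex.I)) *
    (circleMap 0 r θ - u)⁻¹) = J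
  push_cast
  split_ifs
  · field_simp
  · field_simp
    simp

lemma cauchyCoeff_eq_zero_of_norm_lt {r : ℝ} (hr : 0 < r) {u : ℂ} (hu : ‖u‖ < r) (n : ℕ) :
    cauchyCoeff r n u = 0 := by
  have hrc : (r : ℂ) ≠ 0 := by exact_mod_cast hr.ne'
  have hit : ∀ k : ℕ, cauchyCoeff r n u = (u / r) ^ k * cauchyCoeff r (n + k) u := by
    intro k
    induction k with
    | zero => simp
    | succ k ih =>
      have := cauchyCoeff_rec hr (n + k + 1 : ℤ) hu.ne
      rw [if_neg (by omega), zero_add, add_sub_cancel_right] at this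
      rw [ih, pow_succ, mul_assoc]
      congr 1
      push_cast
      rw [← add_assoc, div_mul_eq_mul_div, ← this]
      field_simp
  have hq : ‖u‖ / r < 1 := (div_lt_one hr).mpr hu
  have hlim : Tendsto (fun k : ℕ => (‖u‖ / r) ^ k * |r - ‖u‖|⁻¹) atTop (𝓝 0) := by
    simpa using (tendsto_pow_atTop_nhds_zero_of_lt_one (by positivity) hq).mul_const |r - ‖u‖|⁻¹
  have : ‖cauchyCoeff r n u‖ ≤ 0 := by
    refine ge_of_tendsto' hlim fun k => ?_
    rw [hit k, norm_mul, norm_pow, norm_div, Complex.norm_of_nonneg hr.le]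
    gcongr
    exact norm_cauchyCoeff_le hr _ hu.ne
  simpa using this

lemma cauchyCoeff_neg_of_norm_lt {r : ℝ} (hr : 0 < r) {u : ℂ} (hu : ‖u‖ < r) (m : ℕ) :
    cauchyCoeff r (-(m + 1)) u = u ^ m / r ^ (m + 1) := by
  have hrc : (r : ℂ) ≠ 0 := by exact_mod_cast hr.ne'
  induction m with
  | zero =>
    have h := cauchyCoeff_rec hr 0 hu.ne
    have h0 := cauchyCoeff_eq_zero_of_norm_lt hr hu 0
    simp only [Nat.cast_zero] at h0
    rw [h0, if_pos rfl] at h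
    simp only [zero_sub, mul_zero, add_zero] at h
    simp only [Nat.cast_zero, zero_add, pow_zero, pow_one]
    field_simp
    rw [mul_comm]; exact h
  | succ m ih =>
    have h := cauchyCoeff_rec hr (-(m + 1)) hu.ne
    rw [if_neg (by omega), ih, zero_add] at h
    have e : (-((m + 1 : ℕ) + 1) : ℤ) = -(m + 1) - 1 := by push_cast; ring
    rw [e, ← mul_right_inj' hrc, h]
    field_simp
    ring

lemma cauchyCoeff_neg_eq_zero_of_lt_norm {r : ℝ} (hr : 0 < r) {u : ℂ} (hu : r < ‖u‖) (m : ℕ) :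
    cauchyCoeff r (-(m + 1)) u = 0 := by
  have hu0 : u ≠ 0 := by rintro rfl; simp at hu; linarith
  have hit : ∀ k : ℕ, cauchyCoeff r (-(m + 1)) u =
      (r / u) ^ k * cauchyCoeff r (-(m + 1) - k) u := by
    intro k
    induction k with
    | zero => simp
    | succ k ih =>
      have := cauchyCoeff_rec hr (-(m + 1) - k : ℤ) hu.ne'
      rw [if_neg (by omega), zero_add] at this
      rw [ih, pow_succ, mul_assoc]
      congr 1
      push_cast
      rw [← sub_sub (-((m : ℤ) + 1)), div_mul_eq_mul_div, this]
      field_simp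
  have hq : r / ‖u‖ < 1 := (div_lt_one (hr.trans hu)).mpr hu
  have hlim : Tendsto (fun k : ℕ => (r / ‖u‖) ^ k * |r - ‖u‖|⁻¹) atTop (𝓝 0) := by
    simpa using (tendsto_pow_atTop_nhds_zero_of_lt_one (by positivity) hq).mul_const |r - ‖u‖|⁻¹
  have : ‖cauchyCoeff r (-(m + 1)) u‖ ≤ 0 := by
    refine ge_of_tendsto' hlim fun k => ?_
    rw [hit k, norm_mul, norm_pow, norm_div, Complex.norm_of_nonneg hr.le]
    gcongr
    exact norm_cauchyCoeff_le hr _ hu.ne'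
  simpa using this

lemma cauchyCoeff_of_lt_norm {r : ℝ} (hr : 0 < r) {u : ℂ} (hu : r < ‖u‖) (n : ℕ) :
    cauchyCoeff r n u = -(r ^ n / u ^ (n + 1)) := by
  have hu0 : u ≠ 0 := by rintro rfl; simp at hu; linarith
  induction n with
  | zero =>
    have h := cauchyCoeff_rec hr 0 hu.ne'
    have h0 := cauchyCoeff_neg_eq_zero_of_lt_norm hr hu 0
    simp only [Nat.cast_zero, zero_add] at h0
    rw [if_pos rfl, zero_sub, h0, mul_zero] at h
    simp only [Nat.cast_zero, pow_zero, zero_add, pow_one]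
    rw [← mul_right_inj' hu0, mul_neg, mul_one_div_cancel hu0]
    linear_combination -h
  | succ n ih =>
    have h := cauchyCoeff_rec hr ((n + 1 : ℕ) : ℤ) hu.ne'
    rw [if_neg (by omega), zero_add] at h
    rw [← mul_right_inj' hu0, ← h]
    push_cast
    rw [add_sub_cancel_right, ih]
    field_simp
    ring

lemma cauchyCoeff_zero (r : ℝ) (u : ℂ) :
    cauchyCoeff r 0 u = (2 * π)⁻¹ • ∫ θ in (0 : ℝ)..(2 * π), (circleMap 0 r θ - u)⁻¹ := by
  simp [cauchyCoeff, fourierCoeffOn_two_pi]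

lemma sq_sub_sq_mul_inv_norm_sq_sub {z u : ℂ} (h : z - u ≠ 0) :
    (‖z‖ ^ 2 - ‖u‖ ^ 2) * (‖z - u‖ ^ 2)⁻¹ = (1 + 2 * (u * (z - u)⁻¹)).re := by
  have h2 : Complex.normSq (z - u) ≠ 0 := by simpa using h
  simp only [← Complex.normSq_eq_norm_sq]
  rw [Complex.inv_def]
  simp only [Complex.add_re, Complex.mul_re, Complex.one_re, Complex.conj_re, Complex.conj_im,
    Complex.mul_im, Complex.ofReal_re, Complex.ofReal_im, Complex.sub_re, Complex.sub_im,
    Complex.re_ofNat, Complex.im_ofNat]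
  field_simp
  simp only [Complex.normSq_apply, Complex.sub_re, Complex.sub_im]
  ring

lemma integral_inv_norm_sq_circleMap_sub {r : ℝ} (hr : 0 < r) {u : ℂ} (hu : ‖u‖ ≠ r) :
    ∫ θ in (0 : ℝ)..(2 * π), (‖circleMap 0 r θ - u‖ ^ 2)⁻¹ = 2 * π * |r ^ 2 - ‖u‖ ^ 2|⁻¹ := by
  have hcont := continuous_inv_circleMap_sub hr hu
  have hpi := Real.two_pi_pos
  have h1 : (r ^ 2 - ‖u‖ ^ 2) * ∫ θ in (0 : ℝ)..(2 * π), (‖circleMap 0 r θ - u‖ ^ 2)⁻¹ =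
      2 * π * (1 + 2 * (u * cauchyCoeff r 0 u)).re := by
    have h2 : ∫ θ in (0 : ℝ)..(2 * π), (1 + 2 * (u * (circleMap 0 r θ - u)⁻¹)) =
        ((2 * π : ℝ) : ℂ) * (1 + 2 * (u * cauchyCoeff r 0 u)) := by
      rw [intervalIntegral.integral_add, intervalIntegral.integral_const_mul,
        intervalIntegral.integral_const_mul, cauchyCoeff_zero, Complex.real_smul]
      · have : (π : ℂ) ≠ 0 := by exact_mod_cast Real.pi_ne_zero
        simp only [intervalIntegral.integral_const, sub_zero, Complex.real_smul]
        push_cast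
        field_simp
      · exact Continuous.intervalIntegrable (by fun_prop) _ _
      · exact Continuous.intervalIntegrable (by fun_prop) _ _
    rw [← Complex.re_ofReal_mul, ← h2, ← intervalIntegral.integral_const_mul]
    refine Eq.trans ?_ (Complex.reCLM.intervalIntegral_comp_comm
      (Continuous.intervalIntegrable (by fun_prop) _ _))
    refine intervalIntegral.integral_congr fun θ _ => ?_
    have := sq_sub_sq_mul_inv_norm_sq_sub (circleMap_sub_ne_zero hr hu θ)
    rw [norm_circleMap_zero, sq_abs] at this
    exact this
  rcases hu.lt_or_gt with h | h
  · have h0 := cauchyCoeff_eq_zero_of_norm_lt hr h 0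
    rw [Nat.cast_zero] at h0
    have hd : 0 < r ^ 2 - ‖u‖ ^ 2 := by nlinarith [norm_nonneg u]
    rw [h0, mul_zero, mul_zero, add_zero, Complex.one_re, mul_one] at h1
    rw [abs_of_pos hd, ← div_eq_mul_inv, eq_div_iff hd.ne', mul_comm]
    exact h1
  · have h0 := cauchyCoeff_of_lt_norm hr h 0
    have hu0 : u ≠ 0 := by rintro rfl; simp at h; linarith
    have h3 : (1 : ℂ) + 2 * (u * cauchyCoeff r 0 u) = ((-1 : ℝ) : ℂ) := by
      rw [Nat.cast_zero] at h0
      rw [h0]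
      push_cast
      field_simp
      norm_num
    have hd : r ^ 2 - ‖u‖ ^ 2 < 0 := by nlinarith [norm_nonneg u]
    rw [h3, Complex.ofReal_re] at h1
    rw [abs_of_neg hd, ← div_eq_mul_inv, eq_div_iff (by linarith)]
    linarith

lemma hasSum_one_div_sq_add_one_sub {α : ℝ} (hα : α ∈ Set.Ioo (0 : ℝ) 1) :
    HasSum (fun n : ℤ => 1 / ((n : ℝ) + 1 - α) ^ 2) (π ^ 2 / Real.sin (π * α) ^ 2) := by
  have hpi := Real.pi_pos
  have hs : 0 < Real.sin (π * α) :=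
    Real.sin_pos_of_pos_of_lt_pi (mul_pos hpi hα.1) (by nlinarith [hα.2])
  have hne : ∀ n : ℤ, α - n ≠ 0 := by
    intro n h
    have h1 : (0 : ℝ) < n := by linarith [hα.1]
    have h2 : (n : ℝ) < 1 := by linarith [hα.2]
    norm_cast at h1 h2
    omega
  have hL2 : MemLp (fun x : ℝ => Complex.exp (α * x * Complex.I)) 2
      (volume.restrict (Set.Ioc 0 (2 * π))) := by
    refine MemLp.of_bound (Continuous.aestronglyMeasurable (by fun_prop)) 1 ?_
    filter_upwards with x
    rw [← Complex.ofReal_mul, Complex.norm_exp_ofReal_mul_I]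
  have h := hasSum_sq_fourierCoeffOn Real.two_pi_pos hL2
  have hval : (2 * π - 0)⁻¹ • ∫ x in (0 : ℝ)..(2 * π),
      ‖Complex.exp (α * x * Complex.I)‖ ^ 2 = 1 := by
    have : ∀ x : ℝ, ‖Complex.exp (α * x * Complex.I)‖ = 1 := fun x => by
      rw [← Complex.ofReal_mul, Complex.norm_exp_ofReal_mul_I]
    simp only [this]
    simp
    field_simp
  rw [hval] at h
  have hcoef : ∀ n : ℤ, ‖fourierCoeffOn Real.two_pi_pos
      (fun x : ℝ => Complex.exp (α * x * Complex.I)) n‖ ^ 2 =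
      Real.sin (π * α) ^ 2 / π ^ 2 * (1 / ((n : ℝ) - α) ^ 2) := by
    intro n
    rw [fourierCoeffOn_two_pi]
    have h1 : ∫ θ in (0 : ℝ)..(2 * π), Complex.exp (-(n * θ * Complex.I)) *
        Complex.exp (α * θ * Complex.I) =
        (Complex.exp (Complex.I * (2 * π * (α - n) : ℝ)) - 1) / ((α - n : ℝ) * Complex.I) := by
      have hc : ((α - n : ℝ) : ℂ) * Complex.I ≠ 0 :=
        mul_ne_zero (by exact_mod_cast hne n) Complex.I_ne_zero
      have h2 := integral_exp_mul_complex (a := 0) (b := 2 * π) hc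
      rw [Complex.ofReal_zero, mul_zero, Complex.exp_zero] at h2
      convert h2 using 2
      · ext θ
        rw [← Complex.exp_add]
        congr 1
        push_cast
        ring
      · congr 2
        push_cast
        ring
    rw [h1, norm_smul, norm_div, Complex.norm_exp_I_mul_ofReal_sub_one, norm_mul, norm_mul, Complex.norm_I,
      mul_one, Complex.norm_real, mul_pow, div_pow, mul_pow, norm_inv, inv_pow]
    simp only [Real.norm_eq_abs, sq_abs]
    have h3 : 2 * π * (α - n) / 2 = π * α - n * π := by ring
    rw [h3, Real.sin_sub_int_mul_pi, mul_pow ((-1 : ℝ) ^ n), ← zpow_natCast ((-1 : ℝ) ^ n), ← zpow_mul,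
      Even.neg_one_zpow (by simp)]
    have h4 := hne n
    have h5 : (n : ℝ) - α ≠ 0 := by rw [← neg_ne_zero]; simpa using h4
    rw [← neg_sub (n : ℝ) α, neg_sq]
    field_simp
  simp only [hcoef] at h
  have h' := h.mul_left (π ^ 2 / Real.sin (π * α) ^ 2)
  rw [← (Equiv.addRight (1 : ℤ)).hasSum_iff] at h'
  rw [mul_one] at h'
  convert! h' using 1
  funext n
  have := hs.ne'
  simp only [Function.comp, Equiv.coe_addRight]
  push_cast
  generalize Real.sin (π * α) = S at this ⊢
  field_simp

lemma norm_biotSavart (ω : Measure ℂ) (z : ℂ) :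
    ‖biotSavart ω z‖ = (2 * π)⁻¹ * ‖∫ u, (z - u)⁻¹ ∂ω‖ := by
  have h : ∀ u : ℂ, Complex.I * (z - u) / (((‖z - u‖ : ℝ) : ℂ) ^ 2) =
      Complex.I * (starRingEnd ℂ) ((z - u)⁻¹) := by
    intro u
    rw [mul_div_assoc, ← Complex.ofReal_pow, ← Complex.normSq_eq_norm_sq, Complex.inv_def,
      map_mul, Complex.conj_conj, Complex.conj_ofReal]
    push_cast
    rw [div_eq_mul_inv]
  rw [biotSavart, norm_smul, Real.norm_of_nonneg (by positivity)]
  simp_rw [h]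
  rw [integral_const_mul, integral_conj, norm_mul, Complex.norm_I, one_mul, RCLike.norm_conj]

lemma lintegral_Ioo_rpow {c α : ℝ} (hc : 0 < c) (hα : 0 < α) {x : ℝ} (hx : 0 < x) :
    ∫⁻ s in Set.Ioo 0 x, ENNReal.ofReal (c * α * s ^ (α - 1)) = ENNReal.ofReal (c * x ^ α) := by
  have hint : IntervalIntegrable (fun s : ℝ => c * α * s ^ (α - 1)) volume 0 x :=
    (intervalIntegral.intervalIntegrable_rpow' (by linarith)).const_mul _
  rw [intervalIntegrable_iff_integrableOn_Ioo_of_le hx.le] at hint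
  rw [← ofReal_integral_eq_lintegral_ofReal hint, ← integral_Ioc_eq_integral_Ioo,
    ← intervalIntegral.integral_of_le hx.le, intervalIntegral.integral_const_mul,
    integral_rpow (Or.inl (by linarith)), sub_add_cancel, Real.zero_rpow hα.ne']
  · congr 1
    field_simp
    ring
  · filter_upwards [ae_restrict_mem measurableSet_Ioo] with s hs
    have := hs.1
    positivity

lemma map_norm_eq_withDensity {ω : Measure ℂ} {c α : ℝ} (hc : 0 < c) (hα : 0 < α)
    (hω : ∀ r > (0 : ℝ), ω (ball (0 : ℂ) r) = ENNReal.ofReal (c * r ^ α)) :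
    ω.map (fun u => ‖u‖) = (volume.restrict (Set.Ioi (0 : ℝ))).withDensity
      fun s => ENNReal.ofReal (c * α * s ^ (α - 1)) := by
  have hIio₁ : ∀ x : ℝ, ω.map (fun u => ‖u‖) (Set.Iio x) =
      if 0 < x then ENNReal.ofReal (c * x ^ α) else 0 := by
    intro x
    rw [Measure.map_apply measurable_norm measurableSet_Iio]
    split_ifs with h
    · rw [← hω x h]
      congr 1
      ext u
      simp
    · convert measure_empty (μ := ω)
      ext u
      simp only [Set.mem_preimage, Set.mem_Iio, Set.mem_empty_iff_false, iff_false]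
      linarith [norm_nonneg u]
  have hIio₂ : ∀ x : ℝ, ((volume.restrict (Set.Ioi (0 : ℝ))).withDensity
      fun s => ENNReal.ofReal (c * α * s ^ (α - 1))) (Set.Iio x) =
      if 0 < x then ENNReal.ofReal (c * x ^ α) else 0 := by
    intro x
    rw [withDensity_apply _ measurableSet_Iio, Measure.restrict_restrict measurableSet_Iio,
      Set.inter_comm, Set.Ioi_inter_Iio]
    split_ifs with h
    · exact lintegral_Ioo_rpow hc hα h
    · simp [Set.Ioo_eq_empty h]
  have hfin : ∀ x : ℝ, (if 0 < x then ENNReal.ofReal (c * x ^ α) else 0) ≠ ∞ := by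
    intro x; split_ifs <;> simp
  have hIco : ∀ (μ : Measure ℝ), (∀ x, μ (Set.Iio x) ≠ ∞) → ∀ a b, a < b →
      μ (Set.Ico a b) = μ (Set.Iio b) - μ (Set.Iio a) := by
    intro μ hμ a b hab
    have : Set.Ico a b = Set.Iio b \ Set.Iio a := by
      ext x
      simp
    rw [this, measure_sdiff (Set.Iio_subset_Iio hab.le)
      measurableSet_Iio.nullMeasurableSet (hμ a)]
  refine Measure.ext_of_Ico' _ _ (fun a b hab => ?_) fun a b hab => ?_
  · exact ne_top_of_le_ne_top ((hIio₁ b).symm ▸ hfin b) (measure_mono fun x hx => hx.2)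
  · rw [hIco _ (fun x => (hIio₁ x).symm ▸ hfin x) a b hab,
      hIco _ (fun x => (hIio₂ x).symm ▸ hfin x) a b hab, hIio₁, hIio₁, hIio₂, hIio₂]

lemma lintegral_comp_norm {ω : Measure ℂ} {c α : ℝ} (hc : 0 < c) (hα : 0 < α)
    (hω : ∀ r > (0 : ℝ), ω (ball (0 : ℂ) r) = ENNReal.ofReal (c * r ^ α))
    {f : ℝ → ℝ} (hf : Measurable f) :
    ∫⁻ u, ENNReal.ofReal (f ‖u‖) ∂ω =
      ∫⁻ s in Set.Ioi (0 : ℝ), ENNReal.ofReal (c * α * s ^ (α - 1) * f s) := by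
  have h1 := lintegral_map (μ := ω) hf.ennreal_ofReal measurable_norm
  rw [← h1, map_norm_eq_withDensity hc hα hω, lintegral_withDensity_eq_lintegral_mul _
    (by fun_prop) hf.ennreal_ofReal]
  refine setLIntegral_congr_fun measurableSet_Ioi fun s hs => ?_
  have : 0 < s := hs
  rw [Pi.mul_apply, ENNReal.ofReal_mul (p := c * α * s ^ (α - 1)) (by positivity)]

lemma ae_norm_ne {ω : Measure ℂ} {c α : ℝ} (hc : 0 < c) (hα : 0 < α)
    (hω : ∀ r > (0 : ℝ), ω (ball (0 : ℂ) r) = ENNReal.ofReal (c * r ^ α)) (r : ℝ) :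
    ∀ᵐ u ∂ω, ‖u‖ ≠ r := by
  have h : (ω.map (fun u => ‖u‖)) {r} = 0 := by
    rw [map_norm_eq_withDensity hc hα hω]
    exact withDensity_absolutelyContinuous _ _ (by simp)
  rw [Measure.map_apply measurable_norm (measurableSet_singleton r)] at h
  rw [ae_iff]
  convert h using 2
  ext u
  simp

lemma lintegral_indicator_Ioi {c α r : ℝ} (hc : 0 < c) (hα : α ∈ Set.Ioo (0 : ℝ) 1) (hr : 0 < r)
    (m : ℕ) :
    ∫⁻ s in Set.Ioi (0 : ℝ), ENNReal.ofReal (c * α * s ^ (α - 1) *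
      (Set.Ioi r).indicator (fun s => r ^ m / s ^ (m + 1)) s) =
      ENNReal.ofReal (c * α * r ^ (α - 1) * (1 / (m + 1 - α))) := by
  have hα0 := hα.1
  have hm : (0 : ℝ) < m + 1 - α := by
    have : (0 : ℝ) ≤ m := m.cast_nonneg
    linarith [hα.2]
  have h1 : ∀ s : ℝ, ENNReal.ofReal (c * α * s ^ (α - 1) *
      (Set.Ioi r).indicator (fun s => r ^ m / s ^ (m + 1)) s) =
      (Set.Ioi r).indicator (fun s => ENNReal.ofReal (c * α * r ^ m * s ^ (α - 2 - m))) s := by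
    intro s
    by_cases hs : s ∈ Set.Ioi r
    · have hs0 : 0 < s := hr.trans hs
      rw [Set.indicator_of_mem hs, Set.indicator_of_mem hs]
      congr 1
      have : s ^ (α - 2 - m) = s ^ (α - 1) / s ^ (m + 1) := by
        rw [← Real.rpow_natCast, ← Real.rpow_sub hs0]
        congr 1
        push_cast
        ring
      rw [this]
      ring
    · simp [Set.indicator_of_notMem hs]
  have hlt : α - 2 - m < -1 := by linarith
  have hint : IntegrableOn (fun s : ℝ => c * α * r ^ m * s ^ (α - 2 - m)) (Set.Ioi r) :=
    (integrableOn_Ioi_rpow_of_lt hlt hr).const_mul _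
  simp_rw [h1]
  rw [setLIntegral_indicator measurableSet_Ioi, Set.Ioi_inter_Ioi, max_eq_left hr.le,
    ← ofReal_integral_eq_lintegral_ofReal hint, integral_const_mul,
    integral_Ioi_rpow_of_lt hlt hr]
  · congr 1
    have h2 : r ^ m * r ^ (α - 2 - m + 1) = r ^ (α - 1) := by
      rw [← Real.rpow_natCast, ← Real.rpow_add hr]
      congr 1
      ring
    have h3 : α - 2 - m + 1 = -(m + 1 - α) := by ring
    rw [← h2, h3]
    field_simp
  · filter_upwards [ae_restrict_mem measurableSet_Ioi] with s hs
    have : 0 < s := hr.trans hs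
    positivity

lemma lintegral_indicator_Iio {c α r : ℝ} (hc : 0 < c) (hα : 0 < α) (hr : 0 < r) (m : ℕ) :
    ∫⁻ s in Set.Ioi (0 : ℝ), ENNReal.ofReal (c * α * s ^ (α - 1) *
      (Set.Iio r).indicator (fun s => s ^ m / r ^ (m + 1)) s) =
      ENNReal.ofReal (c * α * r ^ (α - 1) * (1 / (m + α))) := by
  have hm : (0 : ℝ) < m + α := by positivity
  have h1 : ∀ s : ℝ, 0 < s → ENNReal.ofReal (c * α * s ^ (α - 1) *
      (Set.Iio r).indicator (fun s => s ^ m / r ^ (m + 1)) s) =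
      (Set.Iio r).indicator
        (fun s => ENNReal.ofReal (c * α / r ^ (m + 1) * s ^ (m + α - 1))) s := by
    intro s hs0
    by_cases hs : s ∈ Set.Iio r
    · rw [Set.indicator_of_mem hs, Set.indicator_of_mem hs]
      congr 1
      have : s ^ (m + α - 1) = s ^ (α - 1) * s ^ m := by
        rw [← Real.rpow_natCast, ← Real.rpow_add hs0]
        congr 1
        ring
      rw [this]
      ring
    · simp [Set.indicator_of_notMem hs]
  rw [setLIntegral_congr_fun measurableSet_Ioi h1]
  have hint : IntervalIntegrable (fun s : ℝ => c * α / r ^ (m + 1) * s ^ (m + α - 1)) volume 0 r :=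
    (intervalIntegral.intervalIntegrable_rpow' (by linarith)).const_mul _
  rw [intervalIntegrable_iff_integrableOn_Ioo_of_le hr.le] at hint
  rw [setLIntegral_indicator measurableSet_Iio, Set.inter_comm, Set.Ioi_inter_Iio,
    ← ofReal_integral_eq_lintegral_ofReal hint, ← integral_Ioc_eq_integral_Ioo,
    ← intervalIntegral.integral_of_le hr.le, intervalIntegral.integral_const_mul,
    integral_rpow (Or.inl (by linarith)), sub_add_cancel, Real.zero_rpow hm.ne']
  · congr 1
    have h2 : r ^ (m + α) = r ^ (α - 1) * r ^ (m + 1) := by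
      rw [← Real.rpow_natCast, ← Real.rpow_add hr]
      congr 1
      push_cast
      ring
    rw [h2, sub_zero]
    field_simp
  · filter_upwards [ae_restrict_mem measurableSet_Ioo] with s hs
    have := hs.1
    positivity

lemma lintegral_norm_cauchyCoeff_le {ω : Measure ℂ} {c α : ℝ} (hc : 0 < c)
    (hα : α ∈ Set.Ioo (0 : ℝ) 1)
    (hω : ∀ r > (0 : ℝ), ω (ball (0 : ℂ) r) = ENNReal.ofReal (c * r ^ α)) {r : ℝ} (hr : 0 < r)
    (n : ℤ) :
    ∫⁻ u, ‖cauchyCoeff r n u‖ₑ ∂ω ≤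
      ENNReal.ofReal (c * α * r ^ (α - 1) * (1 / |(n : ℝ) + 1 - α|)) := by
  have hae := ae_norm_ne hc hα.1 hω r
  obtain ⟨m, rfl | rfl⟩ : ∃ m : ℕ, n = m ∨ n = -(m + 1) := by
    rcases le_or_gt 0 n with h | h
    · exact ⟨n.toNat, Or.inl (by omega)⟩
    · exact ⟨(-n - 1).toNat, Or.inr (by omega)⟩
  · have hm : (0 : ℝ) < m + 1 - α := by
      have : (0 : ℝ) ≤ m := m.cast_nonneg
      linarith [hα.2]
    have hf : Measurable ((Set.Ioi r).indicator (fun s => r ^ m / s ^ (m + 1))) :=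
      Measurable.indicator (by fun_prop) measurableSet_Ioi
    rw [Int.cast_natCast, abs_of_pos hm, ← lintegral_indicator_Ioi hc hα hr,
      ← lintegral_comp_norm hc hα.1 hω hf]
    refine lintegral_mono_ae ?_
    filter_upwards [hae] with u hu
    rw [← ofReal_norm]
    apply ENNReal.ofReal_le_ofReal
    rcases hu.lt_or_gt with h | h
    · rw [cauchyCoeff_eq_zero_of_norm_lt hr h, norm_zero]
      exact Set.indicator_nonneg (fun s hs => by have := hr.trans hs; positivity) _
    · rw [Set.indicator_of_mem (Set.mem_Ioi.mpr h), cauchyCoeff_of_lt_norm hr h, norm_neg,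
        norm_div, norm_pow, norm_pow, Complex.norm_of_nonneg hr.le]
  · have hm : (0 : ℝ) < m + α := by have := hα.1; positivity
    have hf : Measurable ((Set.Iio r).indicator (fun s : ℝ => s ^ m / r ^ (m + 1))) :=
      Measurable.indicator (by fun_prop) measurableSet_Iio
    have he : |((-((m : ℤ) + 1) : ℤ) : ℝ) + 1 - α| = m + α := by
      rw [← abs_of_pos hm, ← abs_neg]
      congr 1
      push_cast
      ring
    rw [he, ← lintegral_indicator_Iio hc hα.1 hr, ← lintegral_comp_norm hc hα.1 hω hf]
    refine lintegral_mono_ae ?_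
    filter_upwards [hae] with u hu
    rw [← ofReal_norm]
    apply ENNReal.ofReal_le_ofReal
    rcases hu.lt_or_gt with h | h
    · rw [Set.indicator_of_mem (Set.mem_Iio.mpr h), cauchyCoeff_neg_of_norm_lt hr h,
        norm_div, norm_pow, norm_pow, Complex.norm_of_nonneg hr.le]
    · rw [cauchyCoeff_neg_eq_zero_of_lt_norm hr h, norm_zero, Set.indicator_of_notMem]
      simpa using h.le

lemma intervalIntegrable_inv_sqrt_abs (a b : ℝ) :
    IntervalIntegrable (fun x : ℝ => (√|x|)⁻¹) volume a b := by
  refine intervalIntegrable_of_even (fun x => ?_) (fun x hx => ?_) (by simp) (by simp)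
  · rw [abs_neg]
  · refine (intervalIntegral.intervalIntegrable_rpow' (r := -(1 / 2)) (by norm_num)).congr ?_
    intro y hy
    rw [Set.uIoc_of_le hx.le] at hy
    simp only
    rw [abs_of_pos hy.1, Real.sqrt_eq_rpow, Real.rpow_neg hy.1.le]

lemma integrableOn_rpow_mul_inv_sqrt {α r : ℝ} (hα : α ∈ Set.Ioo (0 : ℝ) 1) (hr : 0 < r) :
    IntegrableOn (fun s : ℝ => s ^ (α - 1) * (√|r ^ 2 - s ^ 2|)⁻¹) (Set.Ioi 0) := by
  have hmeas : Measurable fun s : ℝ => s ^ (α - 1) * (√|r ^ 2 - s ^ 2|)⁻¹ := by fun_prop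
  have hnorm : ∀ s : ℝ, 0 < s → ‖s ^ (α - 1) * (√|r ^ 2 - s ^ 2|)⁻¹‖ =
      s ^ (α - 1) * (√|r ^ 2 - s ^ 2|)⁻¹ := fun s hs => Real.norm_of_nonneg (by positivity)
  have hinv : ∀ s t : ℝ, 0 < t → t ^ 2 ≤ |r ^ 2 - s ^ 2| → (√|r ^ 2 - s ^ 2|)⁻¹ ≤ t⁻¹ :=
    fun s t ht h => inv_anti₀ ht (Real.le_sqrt_of_sq_le h)
  have hU : Set.Ioi (0 : ℝ) = Set.Ioc 0 (r / 2) ∪ (Set.Ioc (r / 2) (2 * r) ∪ Set.Ioi (2 * r)) := by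
    rw [Set.Ioc_union_Ioi_eq_Ioi (by linarith), Set.Ioc_union_Ioi_eq_Ioi (by linarith)]
  rw [hU]
  refine IntegrableOn.union ?_ (IntegrableOn.union ?_ ?_)
  · have h1 : IntegrableOn (fun s : ℝ => s ^ (α - 1) * (r / 2)⁻¹) (Set.Ioc 0 (r / 2)) :=
      (intervalIntegrable_iff_integrableOn_Ioc_of_le (by linarith)).mp
        ((intervalIntegral.intervalIntegrable_rpow' (by linarith [hα.1])).mul_const _)
    refine h1.mono' hmeas.aestronglyMeasurable ?_
    filter_upwards [ae_restrict_mem measurableSet_Ioc] with s hs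
    have hs0 := hs.1
    rw [hnorm s hs0]
    refine mul_le_mul_of_nonneg_left (hinv _ _ (by positivity) ?_) (by positivity)
    rw [abs_of_nonneg] <;> nlinarith [hs.2]
  · have h1 : IntegrableOn (fun s : ℝ => (r / 2) ^ (α - 1) * ((√|s - r|)⁻¹ * (√r)⁻¹))
        (Set.Ioc (r / 2) (2 * r)) := by
      refine (intervalIntegrable_iff_integrableOn_Ioc_of_le (by linarith)).mp ?_
      have h := intervalIntegrable_inv_sqrt_abs (r / 2 - r) (2 * r - r)
      simpa using ((h.comp_sub_right r).mul_const (√r)⁻¹).const_mul ((r / 2) ^ (α - 1))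
    refine h1.mono' hmeas.aestronglyMeasurable ?_
    filter_upwards [ae_restrict_mem measurableSet_Ioc] with s hs
    have hs0 : 0 < s := by linarith [hs.1]
    rw [hnorm s hs0]
    have h2 : s ^ (α - 1) ≤ (r / 2) ^ (α - 1) :=
      Real.rpow_le_rpow_of_nonpos (by linarith) hs.1.le (by linarith [hα.2])
    have h3 : |r ^ 2 - s ^ 2| = |s - r| * (s + r) := by
      have h := abs_mul (s - r) (s + r)
      rw [abs_of_pos (by linarith : 0 < s + r)] at h
      rw [← h, ← abs_neg]
      congr 1
      ring
    have h4 : (√(s + r))⁻¹ ≤ (√r)⁻¹ :=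
      inv_anti₀ (Real.sqrt_pos.mpr hr) (Real.sqrt_le_sqrt (by linarith))
    rw [h3, Real.sqrt_mul (abs_nonneg _), mul_inv]
    gcongr
  · have h1 : IntegrableOn (fun s : ℝ => 2 * s ^ (α - 2)) (Set.Ioi (2 * r)) :=
      (integrableOn_Ioi_rpow_of_lt (by linarith [hα.2]) (by linarith)).const_mul 2
    refine h1.mono' hmeas.aestronglyMeasurable ?_
    filter_upwards [ae_restrict_mem measurableSet_Ioi] with s hs
    have hs' : 2 * r < s := hs
    have hs0 : 0 < s := by linarith
    rw [hnorm s hs0]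
    have h2 : s ^ (α - 2) = s ^ (α - 1) * s⁻¹ := by
      rw [← Real.rpow_neg_one, ← Real.rpow_add hs0]
      congr 1
      ring
    have h3 : (√|r ^ 2 - s ^ 2|)⁻¹ ≤ (s / 2)⁻¹ := by
      apply hinv _ _ (by positivity)
      rw [abs_of_nonpos] <;> nlinarith
    calc s ^ (α - 1) * (√|r ^ 2 - s ^ 2|)⁻¹ ≤ s ^ (α - 1) * (s / 2)⁻¹ := by gcongr
      _ = 2 * s ^ (α - 2) := by rw [h2]; field_simp

lemma integral_inv_norm_circleMap_sub_le {r : ℝ} (hr : 0 < r) {u : ℂ} (hu : ‖u‖ ≠ r) :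
    ∫ θ in (0 : ℝ)..(2 * π), ‖(circleMap 0 r θ - u)⁻¹‖ ≤ 2 * π * (√|r ^ 2 - ‖u‖ ^ 2|)⁻¹ := by
  have hcont := continuous_inv_circleMap_sub hr hu
  have hcont2 : Continuous fun θ => (‖circleMap 0 r θ - u‖ ^ 2)⁻¹ :=
    (hcont.norm.pow 2).congr fun θ => by simp
  have hpi := Real.two_pi_pos
  set A := √|r ^ 2 - ‖u‖ ^ 2| with hA
  have hpos : 0 < |r ^ 2 - ‖u‖ ^ 2| := by
    rw [abs_pos, sub_ne_zero, Ne, pow_left_inj₀ hr.le (norm_nonneg u) two_ne_zero]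
    exact hu.symm
  have hA0 : 0 < A := Real.sqrt_pos.mpr hpos
  have hA2 : |r ^ 2 - ‖u‖ ^ 2| = A ^ 2 := (Real.sq_sqrt hpos.le).symm
  calc ∫ θ in (0 : ℝ)..(2 * π), ‖(circleMap 0 r θ - u)⁻¹‖
      ≤ ∫ θ in (0 : ℝ)..(2 * π), (A / 2 * (‖circleMap 0 r θ - u‖ ^ 2)⁻¹ + A⁻¹ / 2) := by
        refine intervalIntegral.integral_mono_on hpi.le
          (Continuous.intervalIntegrable (by fun_prop) _ _)
          (Continuous.intervalIntegrable (by fun_prop) _ _) fun θ _ => ?_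
        rw [norm_inv, ← inv_pow]
        generalize ‖circleMap 0 r θ - u‖⁻¹ = x
        have : 0 ≤ A / 2 * (x - A⁻¹) ^ 2 := by positivity
        have h2 : A / 2 * (x - A⁻¹) ^ 2 = A / 2 * x ^ 2 + A⁻¹ / 2 - x := by
          field_simp
          ring
        linarith
    _ = 2 * π * A⁻¹ := by
        rw [intervalIntegral.integral_add (Continuous.intervalIntegrable (by fun_prop) _ _)
          (by simp), intervalIntegral.integral_const_mul,
          integral_inv_norm_sq_circleMap_sub hr hu, hA2]
        simp only [intervalIntegral.integral_const, smul_eq_mul]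
        field_simp
        ring

lemma integrable_prod_inv_circleMap_sub {ω : Measure ℂ} [SigmaFinite ω] {c α : ℝ} (hc : 0 < c)
    (hα : α ∈ Set.Ioo (0 : ℝ) 1)
    (hω : ∀ r > (0 : ℝ), ω (ball (0 : ℂ) r) = ENNReal.ofReal (c * r ^ α)) {r : ℝ} (hr : 0 < r) :
    Integrable (fun p : ℝ × ℂ => (circleMap 0 r p.1 - p.2)⁻¹)
      ((volume.restrict (Set.Ioc 0 (2 * π))).prod ω) := by
  have hpi := Real.two_pi_pos
  have hmeas : Measurable fun p : ℝ × ℂ => (circleMap 0 r p.1 - p.2)⁻¹ := by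
    have : Continuous fun p : ℝ × ℂ => circleMap 0 r p.1 - p.2 := by fun_prop
    exact this.measurable.inv
  refine ⟨hmeas.aestronglyMeasurable, ?_⟩
  rw [HasFiniteIntegral, lintegral_prod_symm' _ hmeas.enorm]
  have hf : Measurable fun s : ℝ => 2 * π * (√|r ^ 2 - s ^ 2|)⁻¹ := by fun_prop
  calc ∫⁻ u, (∫⁻ θ in Set.Ioc (0 : ℝ) (2 * π), ‖(circleMap 0 r θ - u)⁻¹‖ₑ) ∂ω
      ≤ ∫⁻ u, ENNReal.ofReal (2 * π * (√|r ^ 2 - ‖u‖ ^ 2|)⁻¹) ∂ω := by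
        refine lintegral_mono_ae ?_
        filter_upwards [ae_norm_ne hc hα.1 hω r] with u hu
        have hcont := continuous_inv_circleMap_sub hr hu
        refine le_trans (le_of_eq ?_)
          (ENNReal.ofReal_le_ofReal (integral_inv_norm_circleMap_sub_le hr hu))
        rw [intervalIntegral.integral_of_le hpi.le, ofReal_integral_eq_lintegral_ofReal]
        · simp only [ofReal_norm]
        · exact (Continuous.integrableOn_Icc (by fun_prop)).mono_set Set.Ioc_subset_Icc_self
        · exact ae_of_all _ fun θ => norm_nonneg _
    _ = ∫⁻ s in Set.Ioi (0 : ℝ),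
          ENNReal.ofReal (c * α * s ^ (α - 1) * (2 * π * (√|r ^ 2 - s ^ 2|)⁻¹)) :=
        lintegral_comp_norm hc hα.1 hω hf
    _ < ∞ := by
        have h := ((integrableOn_rpow_mul_inv_sqrt hα hr).const_mul
          (c * α * (2 * π))).lintegral_lt_top
        refine lt_of_eq_of_lt ?_ h
        congr 1 with s
        congr 1
        ring

lemma fourierCoeffOn_integral_inv_circleMap_sub {ν : Measure ℂ} [SFinite ν] {r : ℝ}
    (hν : Integrable (fun p : ℝ × ℂ => (circleMap 0 r p.1 - p.2)⁻¹)
      ((volume.restrict (Set.Ioc 0 (2 * π))).prod ν)) (n : ℤ) :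
    fourierCoeffOn Real.two_pi_pos (fun θ => ∫ u, (circleMap 0 r θ - u)⁻¹ ∂ν) n =
      ∫ u, cauchyCoeff r n u ∂ν := by
  have hpi := Real.two_pi_pos
  simp only [cauchyCoeff, fourierCoeffOn_two_pi]
  rw [integral_smul]
  congr 1
  simp only [intervalIntegral.integral_of_le hpi.le, ← integral_const_mul]
  refine integral_integral_swap ?_
  refine Integrable.bdd_mul (c := 1) hν ?_ ?_
  · exact Continuous.aestronglyMeasurable (by fun_prop)
  · exact ae_of_all _ fun p => (norm_exp_neg_int_mul_mul_I n p.1).le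

lemma stronglyMeasurable_integral_inv_circleMap_sub (ν : Measure ℂ) [SFinite ν] (r : ℝ) :
    StronglyMeasurable fun θ => ∫ u, (circleMap 0 r θ - u)⁻¹ ∂ν := by
  have h : Measurable fun p : ℝ × ℂ => (circleMap 0 r p.1 - p.2)⁻¹ := by
    have : Continuous fun p : ℝ × ℂ => circleMap 0 r p.1 - p.2 := by fun_prop
    exact this.measurable.inv
  exact h.stronglyMeasurable.integral_prod_right

/-- An exhaustion of the complement of the circle of radius `r` by bounded sets at positive
distance from that circle. -/
def awayFromCircle (r : ℝ) (N : ℕ) : Set ℂ :=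
  {u | ((N : ℝ) + 1)⁻¹ ≤ |r - ‖u‖|} ∩ ball 0 (N + 1)

lemma measurableSet_awayFromCircle (r : ℝ) (N : ℕ) : MeasurableSet (awayFromCircle r N) :=
  (measurableSet_le measurable_const (by fun_prop)).inter measurableSet_ball

lemma monotone_awayFromCircle (r : ℝ) : Monotone (awayFromCircle r) := by
  intro M N h u hu
  have hMN : (M : ℝ) ≤ N := by exact_mod_cast h
  have h1 : ((N : ℝ) + 1)⁻¹ ≤ ((M : ℝ) + 1)⁻¹ := inv_anti₀ (by positivity) (by linarith)
  exact ⟨h1.trans hu.1, ball_subset_ball (by linarith) hu.2⟩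

lemma iUnion_awayFromCircle (r : ℝ) : ⋃ N, awayFromCircle r N = {u | ‖u‖ ≠ r} := by
  ext u
  simp only [Set.mem_iUnion, Set.mem_ofPred_eq]
  constructor
  · rintro ⟨N, h1, -⟩ h
    rw [Set.mem_ofPred_eq, h, sub_self, abs_zero] at h1
    exact absurd h1 (not_le.mpr (by positivity))
  · intro h
    have hp : 0 < |r - ‖u‖| := abs_pos.mpr (sub_ne_zero.mpr (Ne.symm h))
    obtain ⟨N, hN⟩ := exists_nat_ge (max |r - ‖u‖|⁻¹ ‖u‖)
    refine ⟨N, ?_, ?_⟩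
    · exact inv_le_of_inv_le₀ hp ((le_max_left _ _).trans (hN.trans (by linarith)))
    · rw [mem_ball_zero_iff]
      linarith [le_max_right |r - ‖u‖|⁻¹ ‖u‖]

lemma lintegral_enorm_sq_integral_awayFromCircle_le {ω : Measure ℂ} [SigmaFinite ω] {c α : ℝ}
    (hc : 0 < c) (hα : α ∈ Set.Ioo (0 : ℝ) 1)
    (hω : ∀ r > (0 : ℝ), ω (ball (0 : ℂ) r) = ENNReal.ofReal (c * r ^ α)) {r : ℝ} (hr : 0 < r)
    (N : ℕ) :
    ∫⁻ θ in Set.Ioc 0 (2 * π), ‖∫ u in awayFromCircle r N, (circleMap 0 r θ - u)⁻¹ ∂ω‖ₑ ^ 2 ≤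
      ENNReal.ofReal (2 * π * ((c * α * r ^ (α - 1)) ^ 2 *
        (π ^ 2 / Real.sin (π * α) ^ 2))) := by
  have hpi := Real.two_pi_pos
  set F : ℝ → ℂ := fun θ => ∫ u in awayFromCircle r N, (circleMap 0 r θ - u)⁻¹ ∂ω with hF
  have hfin : ω (awayFromCircle r N) < ∞ := by
    refine (measure_mono Set.inter_subset_right).trans_lt ?_
    rw [hω _ (by positivity)]
    exact ENNReal.ofReal_lt_top
  have hL2 : MemLp F 2 (volume.restrict (Set.Ioc 0 (2 * π))) := by
    refine MemLp.of_bound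
      (stronglyMeasurable_integral_inv_circleMap_sub _ r).aestronglyMeasurable
      ((N + 1) * ω.real (awayFromCircle r N)) (ae_of_all _ fun θ => ?_)
    refine norm_setIntegral_le_of_norm_le_const hfin fun u hu => ?_
    rw [norm_inv]
    refine inv_le_of_inv_le₀ (by positivity) (hu.1.trans ?_)
    exact abs_sub_norm_le_norm_circleMap_sub hr u θ
  have hint : Integrable (fun p : ℝ × ℂ => (circleMap 0 r p.1 - p.2)⁻¹)
      ((volume.restrict (Set.Ioc 0 (2 * π))).prod (ω.restrict (awayFromCircle r N))) :=
    (integrable_prod_inv_circleMap_sub hc hα hω hr).mono_measure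
      (Measure.prod_mono le_rfl Measure.restrict_le_self)
  have hcoef : ∀ n : ℤ, ‖fourierCoeffOn Real.two_pi_pos F n‖ ^ 2 ≤
      (c * α * r ^ (α - 1)) ^ 2 * (1 / ((n : ℝ) + 1 - α) ^ 2) := by
    intro n
    rw [hF, fourierCoeffOn_integral_inv_circleMap_sub hint]
    have h1 : ‖∫ u in awayFromCircle r N, cauchyCoeff r n u ∂ω‖ₑ ≤
        ENNReal.ofReal (c * α * r ^ (α - 1) * (1 / |(n : ℝ) + 1 - α|)) :=
      (enorm_integral_le_lintegral_enorm _).trans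
        ((lintegral_mono' Measure.restrict_le_self le_rfl).trans
          (lintegral_norm_cauchyCoeff_le hc hα hω hr n))
    have hα0 := hα.1
    rw [← ofReal_norm, ENNReal.ofReal_le_ofReal_iff (by positivity)] at h1
    calc _ ≤ (c * α * r ^ (α - 1) * (1 / |(n : ℝ) + 1 - α|)) ^ 2 := by gcongr
      _ = _ := by rw [mul_pow, div_pow, sq_abs, one_pow]
  have hsum := hasSum_sq_fourierCoeffOn Real.two_pi_pos hL2
  have hle := hasSum_le hcoef hsum ((hasSum_one_div_sq_add_one_sub hα).mul_left _)
  rw [sub_zero, smul_eq_mul, inv_mul_le_iff₀ hpi, intervalIntegral.integral_of_le hpi.le] at hle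
  refine le_trans (le_of_eq ?_) (ENNReal.ofReal_le_ofReal hle)
  rw [ofReal_integral_eq_lintegral_ofReal]
  · simp only [ENNReal.ofReal_pow (norm_nonneg _), ofReal_norm, hF]
  · exact hL2.integrable_norm_pow two_ne_zero
  · exact ae_of_all _ fun θ => by positivity

lemma lintegral_enorm_sq_integral_inv_circleMap_sub_le {ω : Measure ℂ} [SigmaFinite ω] {c α : ℝ}
    (hc : 0 < c) (hα : α ∈ Set.Ioo (0 : ℝ) 1)
    (hω : ∀ r > (0 : ℝ), ω (ball (0 : ℂ) r) = ENNReal.ofReal (c * r ^ α)) {r : ℝ} (hr : 0 < r) :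
    ∫⁻ θ in Set.Ioc 0 (2 * π), ‖∫ u, (circleMap 0 r θ - u)⁻¹ ∂ω‖ₑ ^ 2 ≤
      ENNReal.ofReal (2 * π * ((c * α * r ^ (α - 1)) ^ 2 *
        (π ^ 2 / Real.sin (π * α) ^ 2))) := by
  have hres : ω.restrict (⋃ N, awayFromCircle r N) = ω := by
    rw [iUnion_awayFromCircle]
    exact Measure.restrict_eq_self_of_ae_mem (ae_norm_ne hc hα.1 hω r)
  have hlim : ∀ᵐ θ ∂volume.restrict (Set.Ioc 0 (2 * π)),
      ‖∫ u, (circleMap 0 r θ - u)⁻¹ ∂ω‖ₑ ^ 2 = liminf (fun N =>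
        ‖∫ u in awayFromCircle r N, (circleMap 0 r θ - u)⁻¹ ∂ω‖ₑ ^ 2) atTop := by
    filter_upwards [(integrable_prod_inv_circleMap_sub hc hα hω hr).prod_right_ae] with θ hθ
    have h := tendsto_setIntegral_of_monotone (measurableSet_awayFromCircle r)
      (monotone_awayFromCircle r) hθ.integrableOn
    rw [hres] at h
    exact (((ENNReal.continuous_pow 2).tendsto _).comp h.enorm).liminf_eq.symm
  rw [lintegral_congr_ae hlim]
  refine (lintegral_liminf_le fun N => ?_).trans ?_
  · exact (stronglyMeasurable_integral_inv_circleMap_sub _ r).measurable.enorm.pow_const 2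
  · exact liminf_le_of_le (by isBoundedDefault) fun b hb => by
      obtain ⟨N, hN⟩ := hb.exists
      exact hN.trans (lintegral_enorm_sq_integral_awayFromCircle_le hc hα hω hr N)

lemma le_lintegral_enorm_sq_integral_inv_circleMap_sub {ω : Measure ℂ} [SigmaFinite ω] {c α : ℝ}
    (hc : 0 < c) (hα : α ∈ Set.Ioo (0 : ℝ) 1)
    (hω : ∀ r > (0 : ℝ), ω (ball (0 : ℂ) r) = ENNReal.ofReal (c * r ^ α)) {r : ℝ} (hr : 0 < r) :
    ENNReal.ofReal (2 * π * (c * r ^ (α - 1)) ^ 2) ≤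
      ∫⁻ θ in Set.Ioc 0 (2 * π), ‖∫ u, (circleMap 0 r θ - u)⁻¹ ∂ω‖ₑ ^ 2 := by
  have hpi := Real.two_pi_pos
  by_cases htop : ∫⁻ θ in Set.Ioc 0 (2 * π), ‖∫ u, (circleMap 0 r θ - u)⁻¹ ∂ω‖ₑ ^ 2 = ∞
  · simp [htop]
  set F : ℝ → ℂ := fun θ => ∫ u, (circleMap 0 r θ - u)⁻¹ ∂ω with hF
  have hmeas : StronglyMeasurable F := stronglyMeasurable_integral_inv_circleMap_sub ω r
  have hL2 : MemLp F 2 (volume.restrict (Set.Ioc 0 (2 * π))) := by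
    refine ⟨hmeas.aestronglyMeasurable, ?_⟩
    rw [eLpNorm_lt_top_iff_lintegral_rpow_enorm_lt_top two_ne_zero ENNReal.ofNat_ne_top]
    simpa using lt_top_iff_ne_top.mpr htop
  have hcoef : fourierCoeffOn Real.two_pi_pos F (-1) = ((c * r ^ (α - 1) : ℝ) : ℂ) := by
    rw [hF, fourierCoeffOn_integral_inv_circleMap_sub
      (integrable_prod_inv_circleMap_sub hc hα hω hr)]
    have h1 : ∀ᵐ u ∂ω, cauchyCoeff r (-1) u = (ball (0 : ℂ) r).indicator (fun _ => (r : ℂ)⁻¹) u := by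
      filter_upwards [ae_norm_ne hc hα.1 hω r] with u hu
      rcases hu.lt_or_gt with h | h
      · have h2 := cauchyCoeff_neg_of_norm_lt hr h 0
        rw [Set.indicator_of_mem (mem_ball_zero_iff.mpr h)]
        simpa using h2
      · have h2 := cauchyCoeff_neg_eq_zero_of_lt_norm hr h 0
        rw [Set.indicator_of_notMem (by simpa using h.le)]
        simpa using h2
    rw [integral_congr_ae h1, integral_indicator_const _ measurableSet_ball, measureReal_def,
      hω r hr, ENNReal.toReal_ofReal (by positivity), Complex.real_smul, ← Complex.ofReal_inv,
      ← Complex.ofReal_mul, Real.rpow_sub_one hr.ne']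
    congr 1
    ring
  have hsum := hasSum_sq_fourierCoeffOn Real.two_pi_pos hL2
  have hle := le_hasSum hsum (-1) fun n _ => by positivity
  rw [hcoef, Complex.norm_real, Real.norm_eq_abs, sq_abs, sub_zero, smul_eq_mul,
    le_inv_mul_iff₀ hpi, intervalIntegral.integral_of_le hpi.le] at hle
  refine (ENNReal.ofReal_le_ofReal hle).trans (le_of_eq ?_)
  rw [ofReal_integral_eq_lintegral_ofReal]
  · simp only [ENNReal.ofReal_pow (norm_nonneg _), ofReal_norm, hF]
  · exact hL2.integrable_norm_pow two_ne_zero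
  · exact ae_of_all _ fun θ => by positivity

lemma sphAvg_eq (ω : Measure ℂ) (r : ℝ) :
    sphAvg ω r = ENNReal.ofReal ((2 * π)⁻¹ ^ 3) *
      ∫⁻ θ in Set.Ioc 0 (2 * π), ‖∫ u, (circleMap 0 r θ - u)⁻¹ ∂ω‖ₑ ^ 2 := by
  have hpi := Real.two_pi_pos
  have h : ∀ θ : ℝ, (‖biotSavart ω ((r : ℂ) * Complex.exp ((θ : ℂ) * Complex.I))‖₊ : ℝ≥0∞) ^ 2 =
      ENNReal.ofReal ((2 * π)⁻¹ ^ 2) * ‖∫ u, (circleMap 0 r θ - u)⁻¹ ∂ω‖ₑ ^ 2 := by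
    intro θ
    rw [← circleMap_zero, ← enorm_eq_nnnorm, ← ofReal_norm, norm_biotSavart,
      ENNReal.ofReal_mul (by positivity), ofReal_norm, mul_pow, ENNReal.ofReal_pow (by positivity)]
  simp_rw [sphAvg, h]
  rw [lintegral_const_mul' _ _ ENNReal.ofReal_ne_top, ← mul_assoc,
    ← ENNReal.ofReal_inv_of_pos hpi, ← ENNReal.ofReal_mul (by positivity),
    restrict_Ioo_eq_restrict_Ioc]
  congr 2
  ring

/-- Theorem 3.1: two-sided bound on the spherical averages under the growth condition. -/
theorem stmt5 (ω : Measure ℂ) [SigmaFinite ω] (c α : ℝ) (hc : 0 < c)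
    (hα : α ∈ Set.Ioo (0 : ℝ) 1)
    (hω : ∀ r > (0 : ℝ), ω (ball (0 : ℂ) r) = ENNReal.ofReal (c * r ^ α)) :
    ∀ r > (0 : ℝ),
      ENNReal.ofReal (c ^ 2 / (4 * π ^ 2) * r ^ (2 * α - 2)) ≤ sphAvg ω r ∧
      sphAvg ω r ≤
        ENNReal.ofReal (c ^ 2 * α ^ 2 / (4 * Real.sin (π * α) ^ 2) * r ^ (2 * α - 2)) := by
  intro r hr
  have hpow : (r ^ (α - 1)) ^ 2 = r ^ (2 * α - 2) := by
    rw [← Real.rpow_natCast, ← Real.rpow_mul hr.le]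
    congr 1
    push_cast
    ring
  have hpi := Real.pi_pos
  have hscale : (0 : ℝ) ≤ (2 * π)⁻¹ ^ 3 := by positivity
  rw [sphAvg_eq]
  constructor
  · refine le_trans (le_of_eq ?_)
      (mul_le_mul_right (le_lintegral_enorm_sq_integral_inv_circleMap_sub hc hα hω hr) _)
    rw [← ENNReal.ofReal_mul hscale, mul_pow, hpow]
    congr 1
    field_simp
    ring
  · refine (mul_le_mul_right
      (lintegral_enorm_sq_integral_inv_circleMap_sub_le hc hα hω hr) _).trans (le_of_eq ?_)
    have hs : Real.sin (π * α) ≠ 0 :=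
      (Real.sin_pos_of_pos_of_lt_pi (mul_pos hpi hα.1) (by nlinarith [hα.2])).ne'
    rw [← ENNReal.ofReal_mul hscale, mul_pow, hpow]
    congr 1
    field_simp
    ring
end
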